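/- arXiv:1702.01377 — 3 statements merged into one kernel-verified Lean document; each statement's English description precedes it below -/
import Mathlib

section
/- (Taylor expansion, first form.) Let k be a nonempty index. Then for z in a neighborhood of 0, F_k(z) = Σ_{m=1}^{∞} (−1)^{m−1} ζ( (1,…,1)_m ⊛ (k∨)⋆ ) z^m, where (1,…,1)_m denotes the index consisting of m ones, ⊛ and ⋆ are as defined below, and ζ is extended ℚ-linearly to linear combinations of admissible indices. -/
open MeasureTheory Filter Topology

namespace Kawashima

/-- The set `A(k) = {k₁, k₁+k₂, …, k₁+⋯+k_{r-1}}` of proper nonempty partial sums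
of an index `k = (k₁, …, k_r)`. -/
def Aset (k : List ℕ) : Finset ℕ :=
  (Finset.Ico 1 k.length).image (fun i => (k.take i).sum)

/-- The Hoffman dual of an index `k`: the unique index `k∨` with the same weight such
that `A(k)` and `A(k∨)` partition `{1, …, wt(k) - 1}`.  It is computed here as the
composition of `wt(k)` whose partial-sum set is the complement of `A(k)`. -/
def hdual (k : List ℕ) : List ℕ :=
  let w := k.sum
  let L := (insert w ((Finset.Icc 1 (w - 1)) \ Aset k)).sort (· ≤ ·)
  L.zipWith (fun a b => a - b) (0 :: L)

/-- `sStar k N = s⋆(k, N) = Σ_{0 < m₁ ≤ ⋯ ≤ m_{r-1} ≤ m_r = N} 1/(m₁^{k₁} ⋯ m_r^{k_r})`.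
For the empty index the value is `1` (empty product), and for a nonempty index and
`N = 0` the value is `0` (empty sum). -/
noncomputable def sStar (k : List ℕ) (N : ℕ) : ℝ :=
  ∑ m : Fin k.length → Fin (N + 1),
    if (∀ i, 0 < (m i : ℕ)) ∧
       (∀ i j : Fin k.length, i ≤ j → (m i : ℕ) ≤ (m j : ℕ)) ∧
       (∀ i : Fin k.length, (i : ℕ) + 1 = k.length → (m i : ℕ) = N)
    then ∏ i : Fin k.length, 1 / ((m i : ℕ) : ℝ) ^ k.get i
    else 0

/-- `SStar k N = S⋆(k, N) = Σ_{n=1}^N s⋆(k, n)`. -/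
noncomputable def SStar (k : List ℕ) (N : ℕ) : ℝ :=
  ∑ n ∈ Finset.Icc 1 N, sStar k n

/-- The binomial coefficient `binom(z, n) = z(z-1)⋯(z-n+1)/n!` for complex `z`. -/
noncomputable def cbinom (z : ℂ) (n : ℕ) : ℂ :=
  (descPochhammer ℂ n).eval z / (n.factorial : ℂ)

/-- The Kawashima function
`F_k(z) = Σ_{n=1}^∞ (-1)^{n-1} s⋆(k∨, n) binom(z, n)`, with `F_∅(z) = 1`. -/
noncomputable def F (k : List ℕ) (z : ℂ) : ℂ :=
  if k = [] then 1
  else ∑' n : ℕ, (-1 : ℂ) ^ n * ((sStar (hdual k) (n + 1) : ℝ) : ℂ) * cbinom z (n + 1)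

/-- The domain `Δ(k) ⊆ (0,1)^{wt(k)}`: `t_j < t_{j+1}` if `j ∈ A(k)` and
`t_j > t_{j+1}` otherwise (positions `1`-indexed). -/
def Delta (k : List ℕ) : Set (Fin k.sum → ℝ) :=
  {t | (∀ j, t j ∈ Set.Ioo (0 : ℝ) 1) ∧
       ∀ (i : Fin k.sum) (h : (i : ℕ) + 1 < k.sum),
         if (i : ℕ) + 1 ∈ Aset k then t i < t ⟨(i : ℕ) + 1, h⟩
         else t ⟨(i : ℕ) + 1, h⟩ < t i}

/-- The multiple zeta value `ζ(k) = Σ_{0 < m₁ < ⋯ < m_r} 1/(m₁^{k₁} ⋯ m_r^{k_r})`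
(as a `tsum`; it converges for admissible `k`), with `ζ(∅) = 1`. -/
noncomputable def mzv (k : List ℕ) : ℝ :=
  ∑' m : Fin k.length → ℕ,
    if (∀ i, 0 < m i) ∧ (∀ i j : Fin k.length, i < j → m i < m j)
    then ∏ i : Fin k.length, 1 / ((m i : ℕ) : ℝ) ^ k.get i
    else 0

/-- `ζ` extended `ℚ`-linearly to formal `ℚ`-linear combinations of indices. -/
noncomputable def zetaL (v : List ℕ →₀ ℚ) : ℝ :=
  v.sum fun k a => (a : ℝ) * mzv k

/-- The Kawashima function extended `ℚ`-linearly to formal combinations of indices. -/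
noncomputable def FL (v : List ℕ →₀ ℚ) (z : ℂ) : ℂ :=
  v.sum fun k a => (a : ℂ) * F k z

/-- Auxiliary harmonic product, on *reversed* indices (so that the rightmost entry of
the index is the head of the list):
`k * l = (k₋ * l, k_r) + (k * l₋, l_s) + (k₋ * l₋, k_r + l_s)`. -/
noncomputable def hstarAux : List ℕ → List ℕ → (List ℕ →₀ ℚ)
  | [], l => Finsupp.single l 1
  | a :: k, [] => Finsupp.single (a :: k) 1
  | a :: k, b :: l =>
      Finsupp.mapDomain (List.cons a) (hstarAux k (b :: l)) +
      Finsupp.mapDomain (List.cons b) (hstarAux (a :: k) l) +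
      Finsupp.mapDomain (List.cons (a + b)) (hstarAux k l)
  termination_by k l => k.length + l.length

/-- The harmonic product `k * l` of two indices, as a `ℚ`-linear combination of
indices. -/
noncomputable def hstar (k l : List ℕ) : List ℕ →₀ ℚ :=
  Finsupp.mapDomain List.reverse (hstarAux k.reverse l.reverse)

/-- Auxiliary product `*̄` on reversed indices:
`k *̄ l = (k₋ *̄ l, k_r) + (k *̄ l₋, l_s) - (k₋ *̄ l₋, k_r + l_s)`. -/
noncomputable def hbarAux : List ℕ → List ℕ → (List ℕ →₀ ℚ)
  | [], l => Finsupp.single l 1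
  | a :: k, [] => Finsupp.single (a :: k) 1
  | a :: k, b :: l =>
      Finsupp.mapDomain (List.cons a) (hbarAux k (b :: l)) +
      Finsupp.mapDomain (List.cons b) (hbarAux (a :: k) l) -
      Finsupp.mapDomain (List.cons (a + b)) (hbarAux k l)
  termination_by k l => k.length + l.length

/-- The harmonic product `k *̄ l` of two indices. -/
noncomputable def hbar (k l : List ℕ) : List ℕ →₀ ℚ :=
  Finsupp.mapDomain List.reverse (hbarAux k.reverse l.reverse)

/-- The product `k ⊛ l = (k₋ * l₋, k_r + l_s)` for nonempty indices `k`, `l`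
(and `0` if either is empty). -/
noncomputable def circAst (k l : List ℕ) : List ℕ →₀ ℚ :=
  match k.reverse, l.reverse with
  | a :: k', b :: l' =>
      Finsupp.mapDomain List.reverse
        (Finsupp.mapDomain (List.cons (a + b)) (hstarAux k' l'))
  | _, _ => 0

/-- `⊛` extended bilinearly to formal combinations. -/
noncomputable def circAstL (v w : List ℕ →₀ ℚ) : List ℕ →₀ ℚ :=
  v.sum fun k a => w.sum fun l b => (a * b) • circAst k l

/-- The star operator `k ↦ k⋆`: the sum over all ways to replace commas by pluses
in groups of consecutive entries,
`(k₁,…,k_r)⋆ = Σ_{0<j₁<⋯<j_q=r} (k₁+⋯+k_{j₁}, …, k_{j_{q-1}+1}+⋯+k_{j_q})`. -/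
noncomputable def starOp : List ℕ → (List ℕ →₀ ℚ)
  | [] => Finsupp.single [] 1
  | [a] => Finsupp.single [a] 1
  | a :: b :: k =>
      Finsupp.mapDomain (List.cons a) (starOp (b :: k)) + starOp ((a + b) :: k)
  termination_by k => k.length

/-- The star operator extended `ℚ`-linearly. -/
noncomputable def starL (v : List ℕ →₀ ℚ) : List ℕ →₀ ℚ :=
  v.sum fun k a => a • starOp k

open Classical in
/-- Kawashima's function `G_k(z)`: the sum over tuples `0 < n₁, …, n_w` with
`n_j < n_{j+1}` if `j ∉ A(k)` and `n_j ≤ n_{j+1}` if `j ∈ A(k)`, of the product of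
the factors `1/(n_j + z)` at positions `j ∈ A(k)`, the factor
`1/n_w - 1/(n_w + z)` at the last position, and `1/n_j` elsewhere. -/
noncomputable def G (k : List ℕ) (z : ℂ) : ℂ :=
  ∑' n : Fin k.sum → ℕ,
    if (∀ j, 0 < n j) ∧
       (∀ (i : Fin k.sum) (h : (i : ℕ) + 1 < k.sum),
          if (i : ℕ) + 1 ∈ Aset k then n i ≤ n ⟨(i : ℕ) + 1, h⟩
          else n i < n ⟨(i : ℕ) + 1, h⟩)
    then ∏ j : Fin k.sum,
      if (j : ℕ) + 1 = k.sum then 1 / ((n j : ℕ) : ℂ) - 1 / (((n j : ℕ) : ℂ) + z)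
      else if (j : ℕ) + 1 ∈ Aset k then 1 / (((n j : ℕ) : ℂ) + z)
      else 1 / ((n j : ℕ) : ℂ)
    else 0

open Classical in
/-- `ζ_k(l) = Σ 1/(n₁^{l₁} ⋯ n_w^{l_w})`, summed over the same set of tuples as in
the definition of `G_k`. -/
noncomputable def zetaIdx (k : List ℕ) (l : List ℕ) : ℝ :=
  ∑' n : Fin k.sum → ℕ,
    if (∀ j, 0 < n j) ∧
       (∀ (i : Fin k.sum) (h : (i : ℕ) + 1 < k.sum),
          if (i : ℕ) + 1 ∈ Aset k then n i ≤ n ⟨(i : ℕ) + 1, h⟩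
          else n i < n ⟨(i : ℕ) + 1, h⟩)
    then ∏ j : Fin k.sum, 1 / ((n j : ℕ) : ℝ) ^ (l.getD (j : ℕ) 0)
    else 0

/-- `C_m(k) = Σ_{l₁,…,l_{r-1} ≥ 0, l_r ≥ 1, l₁+⋯+l_r = m}
ζ_k(1,…,1 (k₁-1 ones), l₁+1, …, 1,…,1 (k_r-1 ones), l_r+1)`. -/
noncomputable def Cm (k : List ℕ) (m : ℕ) : ℝ :=
  ∑ l : Fin k.length → Fin (m + 1),
    if (∑ i, (l i : ℕ)) = m ∧
       (∀ i : Fin k.length, (i : ℕ) + 1 = k.length → 1 ≤ (l i : ℕ))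
    then zetaIdx k
      ((List.ofFn (fun i : Fin k.length =>
          List.replicate (k.get i - 1) 1 ++ [(l i : ℕ) + 1])).flatten)
    else 0

/-- The iterated integral `A_m(k)` over `Δ((k,1,…,1))` (`m` trailing ones) of
`ω_{δ(1)}(t₁) ⋯ ω_{δ(w-1)}(t_{w-1}) · dt_w/(1-t_w) · dt_{w+1}/t_{w+1} ⋯ dt_{w+m}/t_{w+m}`. -/
noncomputable def Aint (k : List ℕ) (m : ℕ) : ℝ :=
  ∫ t in Delta (k ++ List.replicate m 1),
    ∏ i : Fin (k ++ List.replicate m 1).sum,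
      if (i : ℕ) + 1 < k.sum then
        (if (i : ℕ) + 1 ∈ Aset k then 1 / (1 - t i) else 1 / t i)
      else if (i : ℕ) + 1 = k.sum then 1 / (1 - t i)
      else 1 / t i

/-- The digamma function `ψ(z) = Γ'(z)/Γ(z)`. -/
noncomputable def digamma (z : ℂ) : ℂ := deriv Complex.Gamma z / Complex.Gamma z


/-- The weight `1 / n ^ a`, set to `0` at `n = 0`. -/
noncomputable def recipPow (a n : ℕ) : ℝ := if n = 0 then 0 else 1 / (n : ℝ) ^ a

lemma recipPow_nonneg (a n : ℕ) : 0 ≤ recipPow a n := by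
  unfold recipPow; positivity

lemma recipPow_add (a b n : ℕ) : recipPow (a + b) n = recipPow a n * recipPow b n := by
  unfold recipPow
  split_ifs
  · simp
  · rw [pow_add, one_div_mul_one_div]

lemma recipPow_anti {a b : ℕ} (h : a ≤ b) (n : ℕ) : recipPow b n ≤ recipPow a n := by
  unfold recipPow
  split_ifs with hn
  · rfl
  · have : (1 : ℝ) ≤ n := by exact_mod_cast Nat.one_le_iff_ne_zero.2 hn
    gcongr

/-- The partial sums `∑_{m < N + e} v m / m ^ a`: strict for `e = 0`, weak for `e = 1`. -/
noncomputable def cumSum (e a : ℕ) (v : ℕ → ℝ) (N : ℕ) : ℝ :=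
  ∑ m ∈ Finset.range (N + e), recipPow a m * v m

/-- The nested sums attached to a reversed index, with innermost function `v`. -/
noncomputable def nestedSum (e : ℕ) (v : ℕ → ℝ) (c : List ℕ) : ℕ → ℝ :=
  c.foldr (cumSum e) v

@[simp] lemma nestedSum_nil (e : ℕ) (v : ℕ → ℝ) : nestedSum e v [] = v := rfl

@[simp] lemma nestedSum_cons (e a : ℕ) (v : ℕ → ℝ) (c : List ℕ) :
    nestedSum e v (a :: c) = cumSum e a (nestedSum e v c) := rfl

lemma nestedSum_append_singleton (e a : ℕ) (v : ℕ → ℝ) (c : List ℕ) :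
    nestedSum e v (c ++ [a]) = nestedSum e (cumSum e a v) c := by
  simp [nestedSum]

lemma cumSum_add (e a : ℕ) (u v : ℕ → ℝ) : cumSum e a (u + v) = cumSum e a u + cumSum e a v := by
  ext N
  simp [cumSum, mul_add, Finset.sum_add_distrib]

lemma nestedSum_add (e : ℕ) (u v : ℕ → ℝ) (c : List ℕ) :
    nestedSum e (u + v) c = nestedSum e u c + nestedSum e v c := by
  induction c with
  | nil => rfl
  | cons a c ih => simp [ih, cumSum_add]

lemma nestedSum_one_nonneg (e : ℕ) (c : List ℕ) (N : ℕ) : 0 ≤ nestedSum e 1 c N := by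
  induction c generalizing N with
  | nil => simp
  | cons a c ih =>
    rw [nestedSum_cons, cumSum]
    exact Finset.sum_nonneg fun m _ => mul_nonneg (recipPow_nonneg _ _) (ih m)

lemma cumSum_succ (e a : ℕ) (v : ℕ → ℝ) (N : ℕ) :
    cumSum e a v (N + 1) = cumSum e a v N + recipPow a (N + e) * v (N + e) := by
  simp only [cumSum]
  rw [show N + 1 + e = N + e + 1 by ring, Finset.sum_range_succ]

lemma cumSum_weak_comp (a b : ℕ) (v : ℕ → ℝ) :
    cumSum 1 b (cumSum 1 a v) = cumSum 1 b (cumSum 0 a v) + cumSum 1 (a + b) v := by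
  ext N
  simp only [cumSum, Pi.add_apply, ← Finset.sum_add_distrib]
  refine Finset.sum_congr rfl fun m _ => ?_
  rw [Finset.sum_range_succ, recipPow_add, add_zero]
  ring

open Finsupp in
/-- Weak nested sums are strict nested sums of the star of the index. -/
lemma nestedSum_weak_eq (l : List ℕ) (hl : l ≠ []) (v : ℕ → ℝ) (N : ℕ) :
    nestedSum 1 v l.reverse N =
      linearCombination ℚ (fun c : List ℕ => nestedSum 0 v c.reverse (N + 1)) (starOp l) := by
  induction l using starOp.induct generalizing v with
  | case1 => exact absurd rfl hl
  | case2 a => simp [starOp, linearCombination_single, cumSum]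
  | case3 a b k ih₁ ih₂ =>
    have h₁ := ih₁ (by simp) (cumSum 0 a v)
    have h₂ := ih₂ (by simp) v
    rw [starOp, map_add, linearCombination_mapDomain, ← h₂]
    simp only [Function.comp_def, List.reverse_cons, nestedSum_append_singleton,
      cumSum_weak_comp, nestedSum_add, Pi.add_apply] at h₁ ⊢
    rw [h₁]

open Finsupp in
/-- The harmonic product is multiplicative for strict nested sums. -/
lemma linearCombination_nestedSum_hstarAux (k l : List ℕ) (N : ℕ) :
    linearCombination ℚ (fun c => nestedSum 0 1 c N) (hstarAux k l) =
      nestedSum 0 1 k N * nestedSum 0 1 l N := by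
  induction N generalizing k l with
  | zero =>
    have key : ∀ (d : ℕ) (u : List ℕ →₀ ℚ),
        linearCombination ℚ (fun c => nestedSum 0 1 c 0) (mapDomain (List.cons d) u) = 0 := by
      intro d u
      rw [linearCombination_mapDomain]
      simp [linearCombination_apply, Function.comp_def, cumSum]
    match k, l with
    | [], l => simp [hstarAux, linearCombination_single]
    | a :: k, [] => simp [hstarAux, linearCombination_single]
    | a :: k, b :: l => simp [hstarAux, key, cumSum]
  | succ N ih =>
    match k, l with
    | [], l => simp [hstarAux, linearCombination_single]
    | a :: k, [] => simp [hstarAux, linearCombination_single]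
    | a :: k, b :: l =>
      have key : ∀ (d : ℕ) (u : List ℕ →₀ ℚ),
          linearCombination ℚ (fun c => nestedSum 0 1 c (N + 1)) (mapDomain (List.cons d) u) =
            linearCombination ℚ (fun c => nestedSum 0 1 c N) (mapDomain (List.cons d) u) +
            recipPow d N * linearCombination ℚ (fun c => nestedSum 0 1 c N) u := by
        intro d u
        rw [linearCombination_mapDomain, linearCombination_mapDomain]
        simp only [linearCombination_apply, Finsupp.sum, Function.comp_def, nestedSum_cons,
          cumSum_succ, smul_add, Finset.sum_add_distrib, Finset.mul_sum, add_zero, mul_smul_comm]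
      have h := ih (a :: k) (b :: l)
      rw [hstarAux, map_add, map_add] at h ⊢
      rw [key, key, key, ih, ih, ih, recipPow_add]
      simp only [nestedSum_cons, cumSum_succ, add_zero] at h ⊢
      linear_combination h

lemma hasSum_fin_succ {r : ℕ} {c : ℕ → ℝ} (hc : ∀ n, 0 ≤ c n) {p : ℕ → (Fin r → ℕ) → ℝ}
    (hp : ∀ n m, 0 ≤ p n m) {s : ℕ → ℝ} (hs : ∀ n, HasSum (p n) (s n))
    (hsum : Summable fun n => c n * s n) :
    HasSum (fun m : Fin (r + 1) → ℕ =>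
      c (m (Fin.last r)) * p (m (Fin.last r)) (fun i => m i.castSucc)) (∑' n, c n * s n) := by
  rw [← (Fin.snocEquiv (fun _ : Fin (r + 1) => ℕ)).hasSum_iff]
  have heq : (fun m : Fin (r + 1) → ℕ =>
      c (m (Fin.last r)) * p (m (Fin.last r)) (fun i => m i.castSucc)) ∘
        (Fin.snocEquiv (fun _ : Fin (r + 1) => ℕ)) = fun x => c x.1 * p x.1 x.2 := by
    ext x
    simp [Fin.snocEquiv_apply]
  rw [heq]
  have hfib : ∀ n, HasSum (fun m => c n * p n m) (c n * s n) := fun n => (hs n).mul_left _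
  have hS : Summable fun x : ℕ × (Fin r → ℕ) => c x.1 * p x.1 x.2 := by
    rw [summable_prod_of_nonneg fun x => mul_nonneg (hc _) (hp _ _)]
    refine ⟨fun n => (hfib n).summable, ?_⟩
    simpa only [(hfib _).tsum_eq] using hsum
  have h := hS.hasSum.prod_fiberwise hfib
  rw [h.tsum_eq]
  exact hS.hasSum

/-- Strictly (`e = 0`) or weakly (`e = 1`) increasing tuples. -/
def IsChain (e : ℕ) {r : ℕ} (m : Fin r → ℕ) : Prop := ∀ i j, i < j → m i < m j + e

lemma isChain_succ {e r : ℕ} {m : Fin (r + 1) → ℕ} :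
    IsChain e m ↔ IsChain e (fun i : Fin r => m i.castSucc) ∧
      ∀ i : Fin r, m i.castSucc < m (Fin.last r) + e := by
  constructor
  · exact fun h => ⟨fun i j hij => h _ _ (Fin.castSucc_lt_castSucc_iff.2 hij),
      fun i => h _ _ (Fin.castSucc_lt_last i)⟩
  · rintro ⟨h₁, h₂⟩ i j hij
    induction j using Fin.lastCases with
    | last =>
      induction i using Fin.lastCases with
      | last => exact absurd hij (lt_irrefl _)
      | cast i => exact h₂ i
    | cast j =>
      induction i using Fin.lastCases with
      | last => exact absurd hij (not_lt.2 (Fin.le_last _))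
      | cast i => exact h₁ i j (Fin.castSucc_lt_castSucc_iff.1 hij)

open Classical in
/-- The summand of the nested sum over tuples bounded by `N`. -/
noncomputable def chainTerm (e : ℕ) {r : ℕ} (g : Fin r → ℕ) (N : ℕ) (m : Fin r → ℕ) : ℝ :=
  if IsChain e m ∧ ∀ i, m i < N + e then ∏ i, recipPow (g i) (m i) else 0

lemma chainTerm_nonneg (e : ℕ) {r : ℕ} (g : Fin r → ℕ) (N : ℕ) (m : Fin r → ℕ) :
    0 ≤ chainTerm e g N m := by
  unfold chainTerm
  split_ifs
  · exact Finset.prod_nonneg fun i _ => recipPow_nonneg _ _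
  · rfl

lemma reverse_ofFn_succ {r : ℕ} (g : Fin (r + 1) → ℕ) :
    (List.ofFn g).reverse = g (Fin.last r) :: (List.ofFn fun i : Fin r => g i.castSucc).reverse := by
  rw [List.ofFn_succ']
  simp

lemma hasSum_chainTerm {e : ℕ} (he : e ≤ 1) {r : ℕ} (g : Fin r → ℕ) (N : ℕ) :
    HasSum (chainTerm e g N) (nestedSum e 1 (List.ofFn g).reverse N) := by
  classical
  induction r generalizing N with
  | zero =>
    have : chainTerm e g N = fun _ => 1 := by
      ext m
      simp [chainTerm, IsChain]
    rw [this]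
    simp
  | succ r ih =>
    set c : ℕ → ℝ := fun n => if n < N + e then recipPow (g (Fin.last r)) n else 0 with hc
    have hfin : ∀ n ∉ Finset.range (N + e),
        c n * nestedSum e 1 (List.ofFn fun i : Fin r => g i.castSucc).reverse n = 0 := by
      intro n hn
      simp only [Finset.mem_range] at hn
      simp [hc, hn]
    have h := hasSum_fin_succ (c := c) (fun n => by
      simp only [hc]; split_ifs; exacts [recipPow_nonneg _ _, le_rfl])
      (chainTerm_nonneg e fun i : Fin r => g i.castSucc) (ih fun i : Fin r => g i.castSucc)
      (summable_of_ne_finset_zero hfin)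
    rw [tsum_eq_sum hfin] at h
    convert h using 1
    · ext m
      simp only [chainTerm, isChain_succ, Fin.forall_fin_succ', hc, Fin.prod_univ_castSucc]
      by_cases h₁ : m (Fin.last r) < N + e
      · have : (∀ i : Fin r, m i.castSucc < m (Fin.last r) + e) →
            ∀ i : Fin r, m i.castSucc < N + e := fun h i => by have := h i; omega
        simp only [h₁, and_true, if_true]
        split_ifs <;> first | tauto | ring
      · simp [h₁]
    · rw [reverse_ofFn_succ, nestedSum_cons, cumSum]
      refine Finset.sum_congr rfl fun n hn => ?_
      simp [hc, Finset.mem_range.1 hn]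

open Classical in
lemma hasSum_chain {e : ℕ} (he : e ≤ 1) {r : ℕ} (g : Fin r → ℕ) {c : ℕ → ℝ} (hc : ∀ n, 0 ≤ c n)
    (hsum : Summable fun n => c n * nestedSum e 1 (List.ofFn g).reverse n) :
    HasSum (fun m : Fin (r + 1) → ℕ =>
      if IsChain e m then c (m (Fin.last r)) * ∏ i : Fin r, recipPow (g i) (m i.castSucc) else 0)
      (∑' n, c n * nestedSum e 1 (List.ofFn g).reverse n) := by
  convert hasSum_fin_succ hc (chainTerm_nonneg e g) (hasSum_chainTerm he g) hsum using 1
  ext m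
  simp only [chainTerm, isChain_succ]
  split_ifs <;> simp

lemma prod_recipPow {r : ℕ} (g m : Fin r → ℕ) :
    ∏ i, recipPow (g i) (m i) =
      if ∀ i, 0 < m i then ∏ i, 1 / (m i : ℝ) ^ g i else 0 := by
  split_ifs with h
  · exact Finset.prod_congr rfl fun i _ => by simp [recipPow, (h i).ne']
  · obtain ⟨i, hi⟩ := not_forall.1 h
    exact Finset.prod_eq_zero (Finset.mem_univ i) (by simp [recipPow, Nat.eq_zero_of_not_pos hi])

lemma exists_ofFn_of_reverse_eq_cons {l c : List ℕ} {a : ℕ} (h : l.reverse = a :: c) :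
    ∃ (r : ℕ) (g : Fin (r + 1) → ℕ), l = List.ofFn g ∧ g (Fin.last r) = a ∧
      (List.ofFn fun i : Fin r => g i.castSucc).reverse = c := by
  have hl : l = (List.ofFn c.reverse.get).concat a := by
    rw [List.ofFn_get, ← List.reverse_reverse l, h]
    simp
  refine ⟨_, Fin.snoc c.reverse.get a, ?_, by simp, ?_⟩
  · rw [List.ofFn_succ', hl]
    simp
  · simp only [Fin.snoc_castSucc]
    rw [List.ofFn_get, List.reverse_reverse]

lemma mzv_ofFn {r : ℕ} (g : Fin r → ℕ) :
    mzv (List.ofFn g) = ∑' m : Fin r → ℕ,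
      if (∀ i, 0 < m i) ∧ (∀ i j, i < j → m i < m j) then ∏ i, 1 / (m i : ℝ) ^ g i else 0 := by
  unfold mzv
  rw [← (Equiv.arrowCongr (finCongr (List.length_ofFn (f := g))) (Equiv.refl ℕ)).tsum_eq]
  refine tsum_congr fun m => ?_
  have h₁ : (∀ i, 0 < m i) ↔ ∀ i : Fin r, 0 < m (Fin.cast List.length_ofFn.symm i) :=
    ⟨fun h i => h _, fun h i => h (Fin.cast List.length_ofFn i)⟩
  have h₂ : (∀ i j, i < j → m i < m j) ↔ ∀ i j : Fin r, i < j →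
      m (Fin.cast List.length_ofFn.symm i) < m (Fin.cast List.length_ofFn.symm j) :=
    ⟨fun h i j hij => h _ _ hij,
      fun h i j hij => h (Fin.cast List.length_ofFn i) (Fin.cast List.length_ofFn j) hij⟩
  simp only [h₁, h₂]
  refine if_congr Iff.rfl ?_ rfl
  exact Fintype.prod_equiv (finCongr List.length_ofFn) _ _ fun i => by
    rw [List.get_ofFn]; rfl

lemma hasSum_mzv {l c : List ℕ} {a : ℕ} (h : l.reverse = a :: c)
    (hsum : Summable fun n => recipPow a n * nestedSum 0 1 c n) :
    HasSum (fun n => recipPow a n * nestedSum 0 1 c n) (mzv l) := by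
  classical
  obtain ⟨r, g, rfl, rfl, rfl⟩ := exists_ofFn_of_reverse_eq_cons h
  have h' := hasSum_chain (Nat.zero_le 1) (fun i : Fin r => g i.castSucc)
    (recipPow_nonneg (g (Fin.last r))) hsum
  rw [mzv_ofFn]
  convert hsum.hasSum
  rw [← h'.tsum_eq]
  refine tsum_congr fun m => ?_
  rw [mul_comm, ← Fin.prod_univ_castSucc fun i => recipPow (g i) (m i), prod_recipPow]
  have hch : IsChain 0 m ↔ ∀ i j, i < j → m i < m j := Iff.rfl
  simp only [hch]
  split_ifs <;> first | rfl | tauto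

lemma sStar_ofFn {r : ℕ} (g : Fin r → ℕ) (N : ℕ) :
    sStar (List.ofFn g) N = ∑ m : Fin r → Fin (N + 1),
      if (∀ i, 0 < (m i : ℕ)) ∧ (∀ i j, i ≤ j → (m i : ℕ) ≤ m j) ∧
        (∀ i : Fin r, (i : ℕ) + 1 = r → (m i : ℕ) = N)
      then ∏ i, 1 / ((m i : ℕ) : ℝ) ^ g i else 0 := by
  unfold sStar
  refine Fintype.sum_equiv
    (Equiv.arrowCongr (finCongr (List.length_ofFn (f := g))) (Equiv.refl _)) _ _ fun m => ?_
  have h₁ : (∀ i, 0 < (m i : ℕ)) ↔ ∀ i : Fin r, 0 < (m (Fin.cast List.length_ofFn.symm i) : ℕ) :=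
    ⟨fun h i => h _, fun h i => h (Fin.cast List.length_ofFn i)⟩
  have h₂ : (∀ i j, i ≤ j → (m i : ℕ) ≤ m j) ↔ ∀ i j : Fin r, i ≤ j →
      (m (Fin.cast List.length_ofFn.symm i) : ℕ) ≤ m (Fin.cast List.length_ofFn.symm j) :=
    ⟨fun h i j hij => h _ _ hij,
      fun h i j hij => h (Fin.cast List.length_ofFn i) (Fin.cast List.length_ofFn j) hij⟩
  have h₃ : (∀ i : Fin (List.ofFn g).length, (i : ℕ) + 1 = (List.ofFn g).length → (m i : ℕ) = N) ↔
      ∀ i : Fin r, (i : ℕ) + 1 = r → (m (Fin.cast List.length_ofFn.symm i) : ℕ) = N :=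
    ⟨fun h i hi => h _ (by simpa using hi),
      fun h i hi => h (Fin.cast List.length_ofFn i) (by simpa using hi)⟩
  simp only [h₁, h₂, h₃]
  refine if_congr Iff.rfl ?_ rfl
  exact Fintype.prod_equiv (finCongr List.length_ofFn) _ _ fun i => by
    rw [List.get_ofFn]; rfl

lemma sStar_eq {l c : List ℕ} {a : ℕ} (h : l.reverse = a :: c) (N : ℕ) :
    sStar l N = recipPow a N * nestedSum 1 1 c N := by
  classical
  obtain ⟨r, g, rfl, rfl, rfl⟩ := exists_ofFn_of_reverse_eq_cons h
  set w : ℕ → ℝ := fun n => if n = N then recipPow (g (Fin.last r)) n else 0 with hw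
  have hfin : ∀ n ∉ ({N} : Finset ℕ),
      w n * nestedSum 1 1 (List.ofFn fun i : Fin r => g i.castSucc).reverse n = 0 := by
    intro n hn
    simp only [Finset.mem_singleton] at hn
    simp [hw, hn]
  have h' := hasSum_chain le_rfl (fun i : Fin r => g i.castSucc) (c := w) (fun n => by
      simp only [hw]; split_ifs; exacts [recipPow_nonneg _ _, le_rfl])
    (summable_of_ne_finset_zero hfin)
  rw [tsum_eq_sum hfin, Finset.sum_singleton] at h'
  have hinj : Function.Injective fun (m : Fin (r + 1) → Fin (N + 1)) (i : Fin (r + 1)) =>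
      (m i : ℕ) := fun m₁ m₂ h => funext fun i => Fin.ext (congrFun h i)
  rw [← hinj.hasSum_iff] at h'
  · have h'' := h'.unique (hasSum_fintype _)
    simp only [hw, if_true] at h''
    rw [h'', sStar_ofFn]
    refine Finset.sum_congr rfl fun m _ => ?_
    have h₁ : (∀ i j, i ≤ j → (m i : ℕ) ≤ m j) ↔ IsChain 1 fun i => (m i : ℕ) := by
      constructor
      · exact fun h i j hij => Nat.lt_succ_of_le (h i j hij.le)
      · intro h i j hij
        rcases hij.eq_or_lt with rfl | hij
        · rfl
        · exact Nat.le_of_lt_succ (h i j hij)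
    have h₂ : (∀ i : Fin (r + 1), (i : ℕ) + 1 = r + 1 → (m i : ℕ) = N) ↔
        (m (Fin.last r) : ℕ) = N := by
      constructor
      · exact fun h => h _ rfl
      · intro h i hi
        rwa [show i = Fin.last r from Fin.ext (by simpa using hi)]
    have h₃ := prod_recipPow g fun i => (m i : ℕ)
    rw [Fin.prod_univ_castSucc] at h₃
    simp only [Function.comp_apply, h₁, h₂]
    by_cases hN : (m (Fin.last r) : ℕ) = N
    · simp only [hN, if_true, and_true] at h₃ ⊢
      rw [mul_comm, h₃]
      split_ifs <;> first | rfl | tauto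
    · simp [hN]
  · intro m hm
    by_contra hne
    refine hm ⟨fun i => ⟨m i, ?_⟩, rfl⟩
    have hch : IsChain 1 m := by
      by_contra h
      simp [h] at hne
    have hlast : m (Fin.last r) = N := by
      by_contra h
      simp [hw, h] at hne
    rcases (Fin.le_last i).eq_or_lt with rfl | hi
    · omega
    · have := hch _ _ hi
      omega

lemma cumSum_one_mono : Monotone (cumSum 0 1 1) :=
  monotone_nat_of_le_succ fun N => by
    rw [cumSum_succ]
    exact le_add_of_nonneg_right (mul_nonneg (recipPow_nonneg _ _) zero_le_one)

lemma cumSum_one_nonneg (N : ℕ) : 0 ≤ cumSum 0 1 1 N := nestedSum_one_nonneg 0 [1] N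

lemma nestedSum_le {c : List ℕ} (hc : ∀ x ∈ c, 0 < x) (N : ℕ) :
    nestedSum 0 1 c N ≤ cumSum 0 1 1 N ^ c.length := by
  induction c generalizing N with
  | nil => simp
  | cons a c ih =>
    rw [List.forall_mem_cons] at hc
    rw [nestedSum_cons, List.length_cons, pow_succ']
    conv_rhs => rw [cumSum, Finset.sum_mul]
    rw [cumSum]
    refine Finset.sum_le_sum fun m hm => ?_
    simp only [Pi.one_apply, mul_one]
    refine mul_le_mul (recipPow_anti hc.1 m) ((ih hc.2 m).trans ?_) (nestedSum_one_nonneg _ _ _)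
      (recipPow_nonneg _ _)
    have : m ≤ N := by simpa using (Finset.mem_range.1 hm).le
    have hle := pow_le_pow_left₀ (cumSum_one_nonneg m) (cumSum_one_mono this) c.length
    simpa [cumSum] using hle

lemma cumSum_one_le_log (n : ℕ) : cumSum 0 1 1 (n + 1) ≤ 1 + Real.log (n + 1 : ℕ) := by
  have h : cumSum 0 1 1 (n + 1) = (harmonic n : ℝ) := by
    simp only [cumSum, add_zero, Finset.sum_range_succ', harmonic]
    simp [recipPow]
  rw [h]
  refine (harmonic_le_one_add_log n).trans ?_
  rcases n.eq_zero_or_pos with rfl | hn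
  · simp
  · gcongr
    simp

lemma prod_le_exp_cumSum {x : ℝ} (hx : 0 ≤ x) (N : ℕ) :
    ∏ j ∈ Finset.range N, (1 + x * recipPow 1 j) ≤ Real.exp (x * cumSum 0 1 1 N) := by
  simp only [cumSum, Finset.mul_sum, Real.exp_sum, add_zero, Pi.one_apply, mul_one]
  refine Finset.prod_le_prod (fun j _ => ?_) fun j _ => ?_
  · have := recipPow_nonneg 1 j
    positivity
  · linarith [Real.add_one_le_exp (x * recipPow 1 j)]

lemma summable_recipPow_two_mul {x : ℝ} (hx : 0 ≤ x) (hx' : x ≤ 1 / 4) (p : ℕ) :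
    Summable fun n => recipPow 2 n * cumSum 0 1 1 n ^ p *
      ∏ j ∈ Finset.range n, (1 + x * recipPow 1 j) := by
  have hs : Summable fun n : ℕ =>
      (p.factorial * 4 ^ p * Real.exp (1 / 2)) * (n : ℝ) ^ (-(3 / 2) : ℝ) :=
    (Real.summable_nat_rpow.2 (by norm_num)).mul_left _
  refine Summable.of_nonneg_of_le (fun n => ?_) (fun n => ?_) hs
  · exact mul_nonneg (mul_nonneg (recipPow_nonneg _ _) (pow_nonneg (cumSum_one_nonneg n) _))
      (Finset.prod_nonneg fun j _ => by have := recipPow_nonneg 1 j; positivity)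
  · rcases n with _ | n
    · simp [recipPow]
    set h := cumSum 0 1 1 (n + 1) with hh
    have hnn : 0 ≤ h := cumSum_one_nonneg _
    have hN : (0 : ℝ) < (n + 1 : ℕ) := by positivity
    have h₁ : h ^ p ≤ p.factorial * 4 ^ p * Real.exp (h / 4) := by
      have := Real.pow_div_factorial_le_exp (h / 4) (by positivity) p
      rw [div_le_iff₀ (by positivity), div_pow, div_le_iff₀ (by positivity)] at this
      linarith
    have h₂ : ∏ j ∈ Finset.range (n + 1), (1 + x * recipPow 1 j) ≤ Real.exp (h / 4) :=
      (prod_le_exp_cumSum hx _).trans (Real.exp_le_exp.2 (by rw [← hh]; nlinarith))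
    have h₃ : Real.exp (h / 4) * Real.exp (h / 4) ≤
        Real.exp (1 / 2) * ((n + 1 : ℕ) : ℝ) ^ (1 / 2 : ℝ) := by
      rw [← Real.exp_add, Real.rpow_def_of_pos hN, ← Real.exp_add]
      have := cumSum_one_le_log n
      exact Real.exp_le_exp.2 (by linarith)
    have h₄ : recipPow 2 (n + 1) = ((n + 1 : ℕ) : ℝ) ^ (-2 : ℝ) := by
      rw [Real.rpow_neg hN.le]
      simp [recipPow]
    calc _ ≤ recipPow 2 (n + 1) * (p.factorial * 4 ^ p * Real.exp (h / 4)) * Real.exp (h / 4) := by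
          have hw := recipPow_nonneg 2 (n + 1)
          exact mul_le_mul (mul_le_mul_of_nonneg_left h₁ hw) h₂
            (Finset.prod_nonneg fun j _ => by have := recipPow_nonneg 1 j; positivity)
            (by positivity)
      _ = recipPow 2 (n + 1) * (p.factorial * 4 ^ p) *
          (Real.exp (h / 4) * Real.exp (h / 4)) := by ring
      _ ≤ recipPow 2 (n + 1) * (p.factorial * 4 ^ p) *
          (Real.exp (1 / 2) * ((n + 1 : ℕ) : ℝ) ^ (1 / 2 : ℝ)) := by
          have := recipPow_nonneg 2 (n + 1)
          gcongr
      _ = (p.factorial * 4 ^ p * Real.exp (1 / 2)) *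
          (((n + 1 : ℕ) : ℝ) ^ (-2 : ℝ) * ((n + 1 : ℕ) : ℝ) ^ (1 / 2 : ℝ)) := by
          rw [h₄]; ring
      _ = _ := by
          rw [← Real.rpow_add hN]
          norm_num

lemma summable_recipPow_mul_nestedSum {a : ℕ} (ha : 2 ≤ a) {c : List ℕ} (hc : ∀ x ∈ c, 0 < x)
    {x : ℝ} (hx : 0 ≤ x) (hx' : x ≤ 1 / 4) :
    Summable fun n => recipPow a n * nestedSum 0 1 c n *
      ∏ j ∈ Finset.range n, (1 + x * recipPow 1 j) := by
  have hprod : ∀ n, 0 ≤ ∏ j ∈ Finset.range n, (1 + x * recipPow 1 j) := fun n =>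
    Finset.prod_nonneg fun j _ => by have := recipPow_nonneg 1 j; positivity
  refine Summable.of_nonneg_of_le (fun n => ?_) (fun n => ?_)
    (summable_recipPow_two_mul hx hx' c.length)
  · exact mul_nonneg (mul_nonneg (recipPow_nonneg _ _) (nestedSum_one_nonneg _ _ _)) (hprod n)
  · refine mul_le_mul_of_nonneg_right ?_ (hprod n)
    exact mul_le_mul (recipPow_anti ha n) (nestedSum_le hc n) (nestedSum_one_nonneg _ _ _)
      (recipPow_nonneg _ _)

lemma zetaL_eq_linearCombination (v : List ℕ →₀ ℚ) :
    zetaL v = Finsupp.linearCombination ℚ mzv v := by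
  simp [zetaL, Finsupp.linearCombination_apply, Rat.smul_def]

lemma mem_support_mapDomain {f : List ℕ → List ℕ} {v : List ℕ →₀ ℚ} {c : List ℕ}
    (h : c ∈ (Finsupp.mapDomain f v).support) : ∃ d ∈ v.support, f d = c := by
  classical
  exact Finset.mem_image.1 (Finsupp.mapDomain_support h)

lemma pos_of_mem_support_hstarAux (k l : List ℕ) (hk : ∀ x ∈ k, 0 < x) (hl : ∀ x ∈ l, 0 < x) :
    ∀ c ∈ (hstarAux k l).support, ∀ x ∈ c, 0 < x := by
  classical
  induction k, l using hstarAux.induct with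
  | case1 l =>
    intro c hc
    rw [hstarAux] at hc
    rwa [Finset.mem_singleton.1 (Finsupp.support_single_subset hc)]
  | case2 a k =>
    intro c hc
    rw [hstarAux] at hc
    rwa [Finset.mem_singleton.1 (Finsupp.support_single_subset hc)]
  | case3 a k b l ih₁ ih₂ ih₃ =>
    have hk' := List.forall_mem_cons.1 hk
    have hl' := List.forall_mem_cons.1 hl
    intro c hc
    rw [hstarAux] at hc
    rcases Finset.mem_union.1 (Finsupp.support_add hc) with hc | hc
    · rcases Finset.mem_union.1 (Finsupp.support_add hc) with hc | hc
      · obtain ⟨d, hd, rfl⟩ := mem_support_mapDomain hc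
        exact List.forall_mem_cons.2 ⟨hk'.1, ih₁ hk'.2 hl d hd⟩
      · obtain ⟨d, hd, rfl⟩ := mem_support_mapDomain hc
        exact List.forall_mem_cons.2 ⟨hl'.1, ih₂ hk hl'.2 d hd⟩
    · obtain ⟨d, hd, rfl⟩ := mem_support_mapDomain hc
      exact List.forall_mem_cons.2 ⟨Nat.add_pos_left hk'.1 _, ih₃ hk'.2 hl'.2 d hd⟩

lemma pos_of_mem_support_starOp (l : List ℕ) (hl : l ≠ []) (hpos : ∀ x ∈ l, 0 < x) :
    ∀ c ∈ (starOp l).support, c ≠ [] ∧ ∀ x ∈ c, 0 < x := by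
  classical
  induction l using starOp.induct with
  | case1 => exact absurd rfl hl
  | case2 a =>
    intro c hc
    rw [starOp] at hc
    rw [Finset.mem_singleton.1 (Finsupp.support_single_subset hc)]
    exact ⟨hl, hpos⟩
  | case3 a b k ih₁ ih₂ =>
    simp only [List.forall_mem_cons] at hpos
    intro c hc
    rw [starOp] at hc
    rcases Finset.mem_union.1 (Finsupp.support_add hc) with hc | hc
    · obtain ⟨d, hd, rfl⟩ := mem_support_mapDomain hc
      exact ⟨by simp, List.forall_mem_cons.2
        ⟨hpos.1, (ih₁ (by simp) (List.forall_mem_cons.2 hpos.2) d hd).2⟩⟩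
    · exact ih₂ (by simp) (List.forall_mem_cons.2 ⟨Nat.add_pos_left hpos.1 _, hpos.2.2⟩) c hc

lemma zipWith_sub_pos (b : ℕ) (L : List ℕ) (hL : (b :: L).Pairwise (· < ·)) :
    ∀ x ∈ L.zipWith (fun a b => a - b) (b :: L), 0 < x := by
  induction L generalizing b with
  | nil => simp
  | cons c L ih =>
    rw [List.pairwise_cons] at hL
    rw [List.zipWith_cons_cons, List.forall_mem_cons]
    exact ⟨Nat.sub_pos_of_lt (hL.1 c (by simp)), ih c hL.2⟩

lemma hdual_pos {k : List ℕ} (hk : k ≠ []) (hpos : ∀ x ∈ k, 0 < x) :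
    ∀ x ∈ hdual k, 0 < x := by
  refine zipWith_sub_pos 0 _ (List.pairwise_cons.2 ⟨fun x hx => ?_, ?_⟩)
  · rw [Finset.mem_sort, Finset.mem_insert, Finset.mem_sdiff, Finset.mem_Icc] at hx
    rcases hx with rfl | hx
    · obtain ⟨a, k, rfl⟩ := List.exists_cons_of_ne_nil hk
      have := hpos a (by simp)
      simp only [List.sum_cons]
      omega
    · omega
  · exact (Finset.sortedLT_sort _).pairwise

lemma hdual_ne_nil (k : List ℕ) : hdual k ≠ [] := by
  intro h
  have h' := congrArg List.length h
  simp only [hdual, List.length_zipWith, List.length_cons, List.length_nil, Finset.length_sort] at h'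
  have := Finset.card_pos.2 ⟨k.sum, Finset.mem_insert_self k.sum (Finset.Icc 1 (k.sum - 1) \ Aset k)⟩
  omega

lemma hasSum_zetaL_circAst {c c' : List ℕ} {b : ℕ} (h : c.reverse = b :: c')
    (hpos : ∀ x ∈ c, 0 < x) (m : ℕ) :
    HasSum (fun n => recipPow (b + 1) n *
        (nestedSum 0 1 (List.replicate m 1) n * nestedSum 0 1 c' n))
      (zetaL (circAst (List.replicate (m + 1) 1) c)) := by
  have hpos' : ∀ x ∈ b :: c', 0 < x := fun x hx => hpos x (by rwa [← List.mem_reverse, h])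
  rw [List.forall_mem_cons] at hpos'
  have hc : circAst (List.replicate (m + 1) 1) c = Finsupp.mapDomain List.reverse
      (Finsupp.mapDomain (List.cons (1 + b)) (hstarAux (List.replicate m 1) c')) := by
    rw [circAst, List.reverse_replicate, List.replicate_succ, h]
  rw [hc, zetaL_eq_linearCombination, Finsupp.linearCombination_mapDomain,
    Finsupp.linearCombination_mapDomain]
  simp only [← linearCombination_nestedSum_hstarAux, Finsupp.linearCombination_apply, Finsupp.sum,
    Finset.mul_sum, mul_smul_comm]
  refine hasSum_sum fun d hd => HasSum.const_smul _ ?_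
  rw [add_comm b 1]
  refine hasSum_mzv (by simp) ?_
  have hd' := pos_of_mem_support_hstarAux _ _ (by simp +contextual [List.mem_replicate])
    hpos'.2 d hd
  simpa using summable_recipPow_mul_nestedSum (a := 1 + b) (by omega) hd' le_rfl (by norm_num)

lemma hasSum_of_eq {E : Type*} [AddCommMonoid E] [TopologicalSpace E] {f g : ℕ → E} {a b : E}
    (h : HasSum f a) (hf : ∀ n, g n = f n) (ha : b = a) : HasSum g b := by
  rwa [funext hf, ha]

/-- The generating function of the strict nested sums of the indices `(1, …, 1)`. -/
lemma hasSum_nestedSum_replicate (x : ℂ) (N : ℕ) :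
    HasSum (fun m => (nestedSum 0 1 (List.replicate m 1) N : ℂ) * x ^ m)
      (∏ j ∈ Finset.range N, (1 + x * (recipPow 1 j : ℂ))) := by
  induction N with
  | zero =>
    convert hasSum_single 0 _ using 1
    · simp
    · intro m hm
      obtain ⟨m, rfl⟩ := Nat.exists_eq_succ_of_ne_zero hm
      simp [List.replicate_succ, cumSum]
  | succ N ih =>
    have h₁ : HasSum (fun m => (nestedSum 0 1 (List.replicate (m + 1) 1) (N + 1) : ℂ) * x ^ (m + 1))
        ((∏ j ∈ Finset.range N, (1 + x * (recipPow 1 j : ℂ))) - 1 +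
          x * recipPow 1 N * ∏ j ∈ Finset.range N, (1 + x * (recipPow 1 j : ℂ))) := by
      have h₂ := (hasSum_nat_add_iff' 1).2 ih
      simp only [Finset.sum_range_one, List.replicate_zero, nestedSum_nil, Pi.one_apply,
        Complex.ofReal_one, pow_zero, mul_one] at h₂
      refine hasSum_of_eq (h₂.add (ih.mul_left (x * recipPow 1 N))) (fun m => ?_) rfl
      simp only [List.replicate_succ, nestedSum_cons, cumSum_succ]
      push_cast
      simp only [add_zero]
      ring
    rw [← hasSum_nat_add_iff' 1]
    refine hasSum_of_eq h₁ (fun m => rfl) ?_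
    rw [Finset.prod_range_succ]
    simp
    ring

lemma hasSum_nestedSum_replicate_real (x : ℝ) (N : ℕ) :
    HasSum (fun m => nestedSum 0 1 (List.replicate m 1) N * x ^ m)
      (∏ j ∈ Finset.range N, (1 + x * recipPow 1 j)) := by
  have h := hasSum_nestedSum_replicate (x : ℂ) N
  exact_mod_cast h

lemma cbinom_succ_eq (z : ℂ) (n : ℕ) :
    (-1) ^ n * cbinom z (n + 1) =
      z * recipPow 1 (n + 1) * ∏ j ∈ Finset.range (n + 1), (1 + -z * (recipPow 1 j : ℂ)) := by
  induction n with
  | zero => simp [cbinom, recipPow]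
  | succ n ih =>
    have hn : ((n : ℂ) + 1) ≠ 0 := by exact_mod_cast n.succ_ne_zero
    have hn' : ((n : ℂ) + 1 + 1) ≠ 0 := by exact_mod_cast (n + 1).succ_ne_zero
    have h : cbinom z (n + 1 + 1) = cbinom z (n + 1) * (z - (n + 1)) / (n + 2) := by
      have hf : ((n + 1).factorial : ℂ) ≠ 0 := by exact_mod_cast (n + 1).factorial_ne_zero
      have hn'' : ((n : ℂ) + 2) ≠ 0 := by exact_mod_cast (n + 1).succ_ne_zero
      unfold cbinom
      rw [descPochhammer_succ_right, Nat.factorial_succ (n + 1)]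
      simp only [Polynomial.eval_mul, Polynomial.eval_sub, Polynomial.eval_X,
        Polynomial.eval_natCast]
      push_cast
      field_simp
      ring
    rw [Finset.prod_range_succ, h]
    calc _ = (-1) ^ n * cbinom z (n + 1) * (((n + 1) - z) / (n + 2)) := by ring
      _ = _ := by
        rw [ih]
        have hn'' : ((n : ℂ) + 2) ≠ 0 := by exact_mod_cast (n + 1).succ_ne_zero
        simp only [recipPow, Nat.succ_ne_zero, if_false, pow_one]
        push_cast
        rw [show (n : ℂ) + 1 + 1 = n + 2 by ring]
        field_simp
        ring

lemma exists_hasSum_taylor {c c' : List ℕ} {b : ℕ} (h : c.reverse = b :: c')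
    (hpos : ∀ x ∈ c, 0 < x) {z : ℂ} (hz : ‖z‖ ≤ 1 / 4) :
    ∃ A : ℂ,
      HasSum (fun n : ℕ => (-1) ^ n * ((recipPow b (n + 1) * nestedSum 0 1 c' (n + 1) : ℝ) : ℂ) *
        cbinom z (n + 1)) A ∧
      HasSum (fun m : ℕ => (-1) ^ m *
        ((zetaL (circAst (List.replicate (m + 1) 1) c) : ℝ) : ℂ) * z ^ (m + 1)) A := by
  have hpos' : ∀ x ∈ b :: c', 0 < x := fun x hx => hpos x (by rwa [← List.mem_reverse, h])
  rw [List.forall_mem_cons] at hpos'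
  set t : ℕ → ℝ := fun n => recipPow (b + 1) (n + 1) * nestedSum 0 1 c' (n + 1) with ht
  have ht0 : ∀ n, 0 ≤ t n := fun n => mul_nonneg (recipPow_nonneg _ _) (nestedSum_one_nonneg _ _ _)
  set f : ℕ × ℕ → ℂ := fun p =>
    (t p.1 : ℂ) * z * ((nestedSum 0 1 (List.replicate p.2 1) (p.1 + 1) : ℂ) * (-z) ^ p.2) with hf
  have hrow : ∀ n, HasSum (fun m => f (n, m)) ((-1) ^ n *
      ((recipPow b (n + 1) * nestedSum 0 1 c' (n + 1) : ℝ) : ℂ) * cbinom z (n + 1)) := by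
    intro n
    refine hasSum_of_eq ((hasSum_nestedSum_replicate (-z) (n + 1)).mul_left ((t n : ℂ) * z))
      (fun m => rfl) ?_
    rw [mul_right_comm, cbinom_succ_eq, ht]
    simp only [recipPow_add]
    push_cast
    ring
  have hnorm : ∀ n, HasSum (fun m => ‖f (n, m)‖)
      (t n * ‖z‖ * ∏ j ∈ Finset.range (n + 1), (1 + ‖z‖ * recipPow 1 j)) := by
    intro n
    refine hasSum_of_eq ((hasSum_nestedSum_replicate_real ‖z‖ (n + 1)).mul_left (t n * ‖z‖))
      (fun m => ?_) rfl
    simp [hf, abs_of_nonneg (ht0 n), abs_of_nonneg (nestedSum_one_nonneg 0 _ _)]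
  have hsum : Summable f := by
    refine Summable.of_norm ?_
    rw [summable_prod_of_nonneg fun p => norm_nonneg _]
    refine ⟨fun n => (hnorm n).summable, ?_⟩
    simp only [(hnorm _).tsum_eq]
    have hs := (summable_nat_add_iff 1).2 (summable_recipPow_mul_nestedSum (a := b + 1)
      (by omega) hpos'.2 (norm_nonneg z) hz)
    refine (hs.mul_left ‖z‖).congr fun n => ?_
    simp only [ht]
    ring
  refine ⟨_, hsum.hasSum.prod_fiberwise hrow, ?_⟩
  refine ((Equiv.prodComm ℕ ℕ).hasSum_iff.2 hsum.hasSum).prod_fiberwise fun m => ?_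
  have hz' := (hasSum_nat_add_iff' 1).2 (hasSum_zetaL_circAst h hpos m)
  have h0 : recipPow (b + 1) 0 = 0 := by simp [recipPow]
  simp only [Finset.sum_range_one, h0, zero_mul, sub_zero] at hz'
  refine hasSum_of_eq ((Complex.hasSum_ofReal.2 hz').mul_left ((-1) ^ m * z ^ (m + 1)))
    (fun n => ?_) ?_
  · simp only [hf, ht, Function.comp_apply, Equiv.prodComm_apply, Prod.swap_prod_mk]
    rw [neg_pow]
    push_cast
    ring
  · ring

lemma sStar_succ_eq {l : List ℕ} (hl : l ≠ []) (n : ℕ) :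
    sStar l (n + 1) = Finsupp.linearCombination ℚ (fun c : List ℕ =>
      nestedSum 0 1 c.reverse (n + 1 + 1) - nestedSum 0 1 c.reverse (n + 1)) (starOp l) := by
  obtain ⟨a, c, h⟩ := List.exists_cons_of_ne_nil (List.reverse_ne_nil_iff.2 hl)
  have h₁ := nestedSum_weak_eq l hl 1 (n + 1)
  have h₂ := nestedSum_weak_eq l hl 1 n
  rw [h, nestedSum_cons] at h₁ h₂
  rw [cumSum_succ, h₂] at h₁
  rw [sStar_eq h, eq_sub_of_add_eq' h₁]
  simp only [Finsupp.linearCombination_apply, Finsupp.sum, smul_sub, Finset.sum_sub_distrib]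

lemma zetaL_circAstL (r : List ℕ) (v : List ℕ →₀ ℚ) :
    zetaL (circAstL (Finsupp.single r 1) v) =
      ∑ c ∈ v.support, (v c : ℝ) * zetaL (circAst r c) := by
  simp [zetaL_eq_linearCombination, circAstL, Finsupp.sum, map_sum, Rat.smul_def,
    Finsupp.support_single]

/-- Taylor expansion (first form): near `z = 0`,
`F_k(z) = Σ_{m=1}^∞ (-1)^{m-1} ζ((1,…,1)_m ⊛ (k∨)⋆) z^m`. -/
theorem F_taylor_one (k : List ℕ) (hk : k ≠ []) (hpos : ∀ x ∈ k, 0 < x) :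
    ∀ᶠ z : ℂ in 𝓝 0,
      F k z = ∑' m : ℕ,
        (-1 : ℂ) ^ m *
          ((zetaL (circAstL (Finsupp.single (List.replicate (m + 1) 1) 1)
            (starOp (hdual k))) : ℝ) : ℂ) * z ^ (m + 1) := by
  have hl := hdual_ne_nil k
  have hl' := hdual_pos hk hpos
  filter_upwards [Metric.closedBall_mem_nhds (0 : ℂ) (by norm_num : (0 : ℝ) < 1 / 4)] with z hz
  rw [mem_closedBall_zero_iff] at hz
  have hex : ∀ c ∈ (starOp (hdual k)).support, ∃ A : ℂ,
      HasSum (fun n : ℕ => (-1) ^ n * ((nestedSum 0 1 c.reverse (n + 1 + 1) -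
        nestedSum 0 1 c.reverse (n + 1) : ℝ) : ℂ) * cbinom z (n + 1)) A ∧
      HasSum (fun m : ℕ => (-1) ^ m *
        ((zetaL (circAst (List.replicate (m + 1) 1) c) : ℝ) : ℂ) * z ^ (m + 1)) A := by
    intro c hc
    obtain ⟨hne, hcpos⟩ := pos_of_mem_support_starOp _ hl hl' c hc
    obtain ⟨b, c', h⟩ := List.exists_cons_of_ne_nil (List.reverse_ne_nil_iff.2 hne)
    simpa only [h, nestedSum_cons, cumSum_succ, add_zero, add_sub_cancel_left] using
      exists_hasSum_taylor h hcpos hz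
  choose! A hA₁ hA₂ using hex
  have h₁ := hasSum_sum fun c hc => (hA₁ c hc).mul_left (starOp (hdual k) c : ℂ)
  have h₂ := hasSum_sum fun c hc => (hA₂ c hc).mul_left (starOp (hdual k) c : ℂ)
  rw [F, if_neg hk]
  refine Eq.trans (b := ∑ c ∈ (starOp (hdual k)).support, (starOp (hdual k) c : ℂ) * A c) ?_ ?_
  · rw [← h₁.tsum_eq]
    refine tsum_congr fun n => ?_
    rw [sStar_succ_eq hl, Finsupp.linearCombination_apply, Finsupp.sum]
    simp only [Rat.smul_def, Complex.ofReal_sum, Complex.ofReal_mul, Complex.ofReal_ratCast,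
      Finset.mul_sum, Finset.sum_mul]
    exact Finset.sum_congr rfl fun c _ => by ring
  · rw [← h₂.tsum_eq]
    refine tsum_congr fun m => ?_
    rw [zetaL_circAstL]
    simp only [Complex.ofReal_sum, Complex.ofReal_mul, Complex.ofReal_ratCast,
      Finset.mul_sum, Finset.sum_mul]
    exact Finset.sum_congr rfl fun c _ => by ring

end Kawashima
end

section
/- (Taylor expansion, second form.) Let k be a nonempty index of weight k=wt(k). For each integer m≥1, let A_m(k) denote the iterated integral A_m(k) = ∫_{Δ((k,1,…,1))} ω_{δ(1)}(t_1)⋯ω_{δ(k−1)}(t_{k−1}) · dt_k/(1−t_k) · dt_{k+1}/t_{k+1} ⋯ dt_{k+m}/t_{k+m}, where (k,1,…,1) is the index k followed by m ones, and δ(j)=1 if j∈A(k), δ(j)=0 otherwise. Then for z in a neighborhood of 0, F_k(z) = Σ_{m=1}^{∞} (−1)^{m−1} A_m(k) z^m. -/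
open MeasureTheory Filter Topology

namespace Kawashima

/-! ### Multiple harmonic star sums of the Hoffman dual -/

/-- The sums `s⋆(k∨, n + 1)`, where `k` has weight `N + 1` and `A(k) = A`, computed recursively
in the weight. -/
noncomputable def starRec (A : Finset ℕ) : ℕ → ℕ → ℝ
  | 0, n => 1 / ((n : ℝ) + 1)
  | N + 1, n =>
      if N + 1 ∈ A then starRec A N n / ((n : ℝ) + 1)
      else (∑ j ∈ Finset.range (n + 1), starRec A N j) / ((n : ℝ) + 1)

lemma mem_Aset {k : List ℕ} {j : ℕ} :
    j ∈ Aset k ↔ ∃ i, 1 ≤ i ∧ i < k.length ∧ (k.take i).sum = j := by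
  simp [Aset, and_assoc]

lemma mem_Aset_append {k l : List ℕ} (hk : k ≠ []) (hl : l ≠ []) {j : ℕ} :
    j ∈ Aset (k ++ l) ↔ j ∈ Aset k ∨ j = k.sum ∨ ∃ i ∈ Aset l, j = k.sum + i := by
  have hk' := List.length_pos_iff.2 hk
  have hl' := List.length_pos_iff.2 hl
  simp only [mem_Aset, List.length_append]
  constructor
  · rintro ⟨i, h1, h2, rfl⟩
    rcases lt_trichotomy i k.length with h | h | h
    · exact Or.inl ⟨i, h1, h, by rw [List.take_append_of_le_length h.le]⟩
    · subst h
      simp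
    · refine Or.inr (Or.inr ⟨_, ⟨i - k.length, by omega, by omega, rfl⟩, ?_⟩)
      rw [List.take_append, List.take_of_length_le h.le, List.sum_append]
  · rintro (⟨i, h1, h2, rfl⟩ | rfl | ⟨_, ⟨i, h1, h2, rfl⟩, rfl⟩)
    · exact ⟨i, h1, by omega, by rw [List.take_append_of_le_length h2.le]⟩
    · exact ⟨k.length, hk', by omega, by simp⟩
    · exact ⟨k.length + i, by omega, by omega, by
        rw [List.take_append, List.take_of_length_le (by omega), List.sum_append]; simp⟩

lemma Aset_singleton (a : ℕ) : Aset [a] = ∅ := by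
  simp [Aset]

lemma lt_sum_of_mem_Aset {k : List ℕ} (hpos : ∀ x ∈ k, 0 < x) {j : ℕ} (hj : j ∈ Aset k) :
    j < k.sum := by
  obtain ⟨i, -, hi, rfl⟩ := mem_Aset.1 hj
  conv_rhs => rw [← List.take_append_drop i k, List.sum_append]
  have hd : k.drop i ≠ [] := by simpa using hi
  have := List.sum_pos (k.drop i) (fun x hx => hpos x (List.mem_of_mem_drop hx)) hd
  omega

lemma sum_take_zipWith_sub (L : List ℕ) (c : ℕ) (hc : ∀ x ∈ L, c ≤ x) (hL : L.Pairwise (· ≤ ·))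
    (i : ℕ) (hi : i < L.length) :
    c + ((L.zipWith (fun a b => a - b) (c :: L)).take (i + 1)).sum = L[i] := by
  induction L generalizing c i with
  | nil => simp at hi
  | cons x L ih =>
    have hx : c ≤ x := hc x (by simp)
    rw [List.pairwise_cons] at hL
    cases i with
    | zero => simp [hx]
    | succ i =>
      have := ih x hL.1 hL.2 i (by simpa using hi)
      simp only [List.zipWith_cons_cons, List.take_succ_cons, List.sum_cons,
        List.getElem_cons_succ] at this ⊢
      omega

lemma pos_of_mem_zipWith_sub (L : List ℕ) (c : ℕ) (hc : ∀ x ∈ L, c < x) (hL : L.Pairwise (· < ·)) :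
    ∀ y ∈ L.zipWith (fun a b => a - b) (c :: L), 0 < y := by
  induction L generalizing c with
  | nil => simp
  | cons x L ih =>
    have hx : c < x := hc x (by simp)
    rw [List.pairwise_cons] at hL
    intro y hy
    rw [List.zipWith_cons_cons, List.mem_cons] at hy
    rcases hy with rfl | hy
    · omega
    · exact ih x hL.1 hL.2 y hy

lemma hdual_spec {k : List ℕ} (hw : 0 < k.sum) :
    hdual k ≠ [] ∧ (∀ x ∈ hdual k, 0 < x) ∧ (hdual k).sum = k.sum ∧
      Aset (hdual k) = Finset.Icc 1 (k.sum - 1) \ Aset k := by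
  set s := insert k.sum ((Finset.Icc 1 (k.sum - 1)) \ Aset k) with hs
  set L := s.sort (· ≤ ·) with hL
  have hd : hdual k = L.zipWith (fun a b => a - b) (0 :: L) := rfl
  have hmem : ∀ x, x ∈ L ↔ x ∈ s := fun x => by simp [hL]
  have hlt : L.Pairwise (· < ·) := by
    have := Finset.sortedLT_sort s
    exact this.pairwise
  have hle : L.Pairwise (· ≤ ·) := hlt.imp le_of_lt
  have hpos : ∀ x ∈ L, 0 < x := by
    intro x hx
    rw [hmem, hs, Finset.mem_insert, Finset.mem_sdiff, Finset.mem_Icc] at hx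
    omega
  have hmax : ∀ x ∈ L, x ≤ k.sum := by
    intro x hx
    rw [hmem, hs, Finset.mem_insert, Finset.mem_sdiff, Finset.mem_Icc] at hx
    omega
  have hwL : k.sum ∈ L := by rw [hmem, hs]; simp
  have hlen : (hdual k).length = L.length := by rw [hd]; simp
  have hLpos : 0 < L.length := List.length_pos_of_mem hwL
  have htake : ∀ i (hi : i < L.length), ((hdual k).take (i + 1)).sum = L[i] := by
    intro i hi
    have := sum_take_zipWith_sub L 0 (fun x _ => Nat.zero_le x) hle i hi
    rw [hd]; omega
  have hmono : ∀ i j (hi : i < L.length) (hj : j < L.length), i < j → L[i] < L[j] :=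
    fun i j hi hj hij => List.pairwise_iff_getElem.1 hlt i j hi hj hij
  have hlast : L[L.length - 1]'(by omega) = k.sum := by
    obtain ⟨i, hi, hi'⟩ := List.getElem_of_mem hwL
    rcases (Nat.le_sub_one_of_lt hi).lt_or_eq with h | h
    · have h1 := hmono i (L.length - 1) hi (by omega) h
      have h2 := hmax _ (List.getElem_mem (l := L) (n := L.length - 1) (by omega))
      omega
    · subst h
      exact hi'
  refine ⟨?_, ?_, ?_, ?_⟩
  · rw [← List.length_pos_iff, hlen]
    exact hLpos
  · rw [hd]
    exact pos_of_mem_zipWith_sub L 0 hpos hlt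
  · rw [← hlast, ← htake, List.take_of_length_le (by omega)]
  · ext x
    rw [mem_Aset]
    have hx : x ∈ Finset.Icc 1 (k.sum - 1) \ Aset k ↔ x ∈ L ∧ x ≠ k.sum := by
      rw [hmem, hs, Finset.mem_insert, Finset.mem_sdiff, Finset.mem_Icc]
      have : x ≤ k.sum - 1 → x ≠ k.sum := by omega
      tauto
    rw [hx]
    constructor
    · rintro ⟨i, h1, h2, rfl⟩
      obtain ⟨i, rfl⟩ : ∃ i', i = i' + 1 := ⟨i - 1, by omega⟩
      rw [htake i (by omega)]
      refine ⟨List.getElem_mem _, ?_⟩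
      rw [← hlast]
      exact (hmono _ _ _ _ (by omega)).ne
    · rintro ⟨h1, h2⟩
      obtain ⟨i, hi, rfl⟩ := List.getElem_of_mem h1
      refine ⟨i + 1, by omega, ?_, htake i hi⟩
      rw [hlen]
      rcases (Nat.le_sub_one_of_lt hi).lt_or_eq with h | h
      · omega
      · subst h
        exact absurd hlast h2

/-- The tuples `0 < m₁ ≤ ⋯ ≤ m_r = n`. -/
def starTuples (r n : ℕ) : Finset (Fin r → ℕ) :=
  (Fintype.piFinset fun _ : Fin r => Finset.range (n + 1)).filter fun m =>
    (∀ i, 0 < m i) ∧ (∀ i j, i ≤ j → m i ≤ m j) ∧ ∀ i : Fin r, (i : ℕ) + 1 = r → m i = n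

lemma mem_starTuples_succ {r n : ℕ} {m : Fin (r + 1) → ℕ} :
    m ∈ starTuples (r + 1) n ↔ (∀ i, 0 < m i) ∧ Monotone m ∧ m (Fin.last r) = n := by
  simp only [starTuples, Finset.mem_filter, Fintype.mem_piFinset, Finset.mem_range]
  constructor
  · rintro ⟨-, h1, h2, h3⟩
    exact ⟨h1, fun i j hij => h2 i j hij, h3 _ (by simp)⟩
  · rintro ⟨h1, h2, h3⟩
    refine ⟨fun i => ?_, h1, fun i j hij => h2 hij, fun i hi => ?_⟩
    · have := h2 (Fin.le_last i)
      omega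
    · rw [← h3]
      congr 1
      ext
      simpa using hi

lemma sStar_eq_sum_starTuples (l : List ℕ) (r : ℕ) (h : l.length = r) (n : ℕ) :
    sStar l n = ∑ m ∈ starTuples r n, ∏ i : Fin r, 1 / (m i : ℝ) ^ l.getD i 0 := by
  subst h
  rw [sStar, starTuples, ← Finset.sum_filter]
  refine Finset.sum_nbij' (fun m i => (m i : ℕ)) (fun m i => Fin.ofNat (n + 1) (m i)) ?_ ?_ ?_ ?_ ?_
  · intro m hm
    simp only [Finset.mem_filter, Fintype.mem_piFinset, Finset.mem_range, Finset.mem_univ,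
      true_and, Fin.val_fin_le] at hm ⊢
    refine ⟨fun i => (m i).2, hm.1, hm.2.1, hm.2.2⟩
  · intro m hm
    simp only [Finset.mem_filter, Fintype.mem_piFinset, Finset.mem_range] at hm
    simp only [Finset.mem_filter, Finset.mem_univ, true_and, Fin.ofNat,
      Nat.mod_eq_of_lt (hm.1 _)]
    exact hm.2
  · intro m _
    simp
  · intro m hm
    simp only [Finset.mem_filter, Fintype.mem_piFinset, Finset.mem_range] at hm
    ext i
    simp [Nat.mod_eq_of_lt (hm.1 _)]
  · intro m _
    simp

lemma sStar_singleton (a : ℕ) {n : ℕ} (hn : 0 < n) : sStar [a] n = 1 / (n : ℝ) ^ a := by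
  have h : starTuples 1 n = {fun _ => n} := by
    ext m
    rw [mem_starTuples_succ, Finset.mem_singleton]
    constructor
    · rintro ⟨-, -, h⟩
      ext i
      rwa [Subsingleton.elim i (Fin.last 0)]
    · rintro rfl
      exact ⟨fun _ => hn, monotone_const, rfl⟩
  rw [sStar_eq_sum_starTuples [a] 1 rfl, h]
  simp

lemma sStar_append_singleton (l : List ℕ) (hl : l ≠ []) (a : ℕ) (n : ℕ) :
    sStar (l ++ [a]) n = (∑ j ∈ Finset.Icc 1 n, sStar l j) / (n : ℝ) ^ a := by
  obtain ⟨r, hr⟩ : ∃ r, l.length = r + 1 := by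
    have := List.length_pos_iff.2 hl
    exact ⟨l.length - 1, by omega⟩
  rw [sStar_eq_sum_starTuples (l ++ [a]) (r + 2) (by simp [hr])]
  simp_rw [sStar_eq_sum_starTuples l (r + 1) hr]
  rw [Finset.sum_sigma', Finset.sum_div]
  refine Finset.sum_nbij' (fun m => ⟨m (Fin.last r).castSucc, Fin.init m⟩)
    (fun p => Fin.snoc (α := fun _ => ℕ) p.2 n) ?_ ?_ ?_ ?_ ?_
  · intro m hm
    obtain ⟨h1, h2, h3⟩ := mem_starTuples_succ.1 hm
    refine Finset.mem_sigma.2 ⟨Finset.mem_Icc.2 ⟨h1 _, ?_⟩, mem_starTuples_succ.2 ⟨?_, ?_, rfl⟩⟩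
    · rw [← h3]
      exact h2 (Fin.le_last _)
    · exact fun i => h1 _
    · exact fun i j hij => h2 (Fin.castSucc_le_castSucc_iff.2 hij)
  · rintro ⟨j, m⟩ hm
    rw [Finset.mem_sigma, Finset.mem_Icc] at hm
    obtain ⟨hj, hm⟩ := hm
    obtain ⟨h1, h2, h3⟩ := mem_starTuples_succ.1 hm
    dsimp only at hj h1 h2 h3 ⊢
    refine mem_starTuples_succ.2 ⟨?_, ?_, by simp⟩
    · intro i
      refine Fin.lastCases ?_ (fun i => ?_) i
      · simp; omega
      · simpa using h1 i
    · intro i i' hii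
      induction i' using Fin.lastCases with
      | last =>
        induction i using Fin.lastCases with
        | last => rfl
        | cast i =>
          have := h2 (Fin.le_last i)
          simp only [Fin.snoc_castSucc, Fin.snoc_last]
          omega
      | cast i' =>
        induction i using Fin.lastCases with
        | last => exact absurd hii (not_le.2 (Fin.castSucc_lt_last i'))
        | cast i =>
          simp only [Fin.snoc_castSucc]
          exact h2 (Fin.castSucc_le_castSucc_iff.1 hii)
  · intro m hm
    obtain ⟨h1, h2, h3⟩ := mem_starTuples_succ.1 hm
    rw [← h3]
    exact Fin.snoc_init_self m
  · rintro ⟨j, m⟩ hm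
    obtain ⟨h1, h2, h3⟩ := mem_starTuples_succ.1 (Finset.mem_sigma.1 hm).2
    dsimp only at h3
    simp [h3]
  · intro m hm
    obtain ⟨h1, h2, h3⟩ := mem_starTuples_succ.1 hm
    rw [Fin.prod_univ_castSucc, h3]
    have e1 : (l ++ [a]).getD ((Fin.last (r + 1) : Fin (r + 2)) : ℕ) 0 = a := by
      simp [List.getD, ← hr]
    have e2 : ∀ i : Fin (r + 1), (l ++ [a]).getD ((i.castSucc : Fin (r + 2)) : ℕ) 0 = l.getD i 0 := by
      intro i
      have : (i : ℕ) < l.length := by omega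
      simp [List.getD, List.getElem?_append_left this]
    rw [e1, div_eq_mul_inv]
    refine congrArg₂ _ (Finset.prod_congr rfl fun i _ => ?_) (by simp)
    rw [e2]
    rfl

lemma sStar_eq_starRec (A : Finset ℕ) (l : List ℕ) (hl : ∀ x ∈ l, 0 < x) (a : ℕ)
    (hA : ∀ j, 1 ≤ j → j ≤ l.sum + a → (j ∈ A ↔ j ∉ Aset (l ++ [a + 1]))) (n : ℕ) :
    sStar (l ++ [a + 1]) (n + 1) = starRec A (l.sum + a) n := by
  induction l using List.reverseRecOn generalizing a n with
  | nil =>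
    induction a with
    | zero => simp [sStar_singleton, starRec]
    | succ a ih =>
      have h : a + 1 ∈ A := (hA (a + 1) (by simp) (by simp)).2 (by simp [Aset_singleton])
      have h' := ih fun j h1 h2 => by
        rw [hA j h1 (by omega)]; simp [Aset_singleton]
      simp only [List.sum_nil, Nat.zero_add, List.nil_append] at h' ⊢
      rw [starRec, if_pos h, ← h', sStar_singleton _ (by simp), sStar_singleton _ (by simp)]
      push_cast
      rw [div_div, ← pow_succ]
  | append_singleton l b ihl =>
    have hb : 0 < b := hl b (by simp)
    obtain ⟨b, rfl⟩ : ∃ b', b = b' + 1 := ⟨b - 1, by omega⟩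
    have hne : l ++ [b + 1] ≠ [] := by simp
    have hmem : ∀ a j, j ∈ Aset (l ++ [b + 1] ++ [a + 1]) ↔
        j ∈ Aset (l ++ [b + 1]) ∨ j = (l ++ [b + 1]).sum := by
      intro a j
      rw [mem_Aset_append hne (by simp), Aset_singleton]
      simp
    have hlt : ∀ j ∈ Aset (l ++ [b + 1]), j < (l ++ [b + 1]).sum :=
      fun j hj => lt_sum_of_mem_Aset hl hj
    induction a with
    | zero =>
      have hs : (l ++ [b + 1]).sum + 0 = l.sum + b + 1 := by simp; omega
      have hs' : (l ++ [b + 1]).sum = l.sum + b + 1 := by simp; omega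
      have hnot : l.sum + b + 1 ∉ A := by
        rw [hA _ (by omega) (by omega), hmem]
        simp [hs']
      have ih := ihl (fun x hx => hl x (by simp [hx])) b fun j h1 h2 => by
        rw [hA j h1 (by omega), hmem]
        have : j ≠ (l ++ [b + 1]).sum := by omega
        rw [or_iff_left this]
      rw [hs, starRec, if_neg hnot, sStar_append_singleton _ hne]
      simp_rw [← ih]
      rw [← Finset.Ico_add_one_right_eq_Icc, Finset.sum_Ico_eq_sum_range]
      simp [add_comm 1]
    | succ a ih =>
      have h : (l ++ [b + 1]).sum + a + 1 ∈ A := by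
        rw [hA _ (by omega) (by omega), hmem]
        rintro (h | h)
        · have := hlt _ h
          omega
        · omega
      have h' := ih fun j h1 h2 => by
        rw [hA j h1 (by omega), hmem, hmem]
      rw [← add_assoc, starRec, if_pos h, ← h', sStar_append_singleton _ hne,
        sStar_append_singleton _ hne]
      push_cast
      rw [div_div, ← pow_succ]

lemma sStar_hdual {k : List ℕ} (hw : 0 < k.sum) (n : ℕ) :
    sStar (hdual k) (n + 1) = starRec (Aset k) (k.sum - 1) n := by
  obtain ⟨hne, hpos, hsum, hA⟩ := hdual_spec hw
  obtain ⟨l, a, hla⟩ : ∃ l a, hdual k = l ++ [a] := by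
    rcases List.eq_nil_or_concat (hdual k) with h | ⟨l, a, h⟩
    · exact absurd h hne
    · exact ⟨l, a, by simpa using h⟩
  rw [hla] at hpos hsum hA ⊢
  have ha : 0 < a := hpos a (by simp)
  obtain ⟨a, rfl⟩ : ∃ a', a = a' + 1 := ⟨a - 1, by omega⟩
  have hs : l.sum + a = k.sum - 1 := by
    simp at hsum; omega
  rw [← hs]
  refine sStar_eq_starRec _ l (fun x hx => hpos x (by simp [hx])) a (fun j h1 h2 => ?_) n
  rw [hA, Finset.mem_sdiff, Finset.mem_Icc]
  have : j ≤ k.sum - 1 := by omega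
  simp [h1, this]

/-! ### Iterated integrals, peeling off the last variable -/

open scoped ENNReal

/-- The domain `Δ` attached to a set `A` of positions, in dimension `n`. -/
def zigzag (A : Finset ℕ) (n : ℕ) : Set (Fin n → ℝ) :=
  {t | (∀ j, t j ∈ Set.Ioo (0 : ℝ) 1) ∧
       ∀ (i : Fin n) (h : (i : ℕ) + 1 < n),
         if (i : ℕ) + 1 ∈ A then t i < t ⟨(i : ℕ) + 1, h⟩
         else t ⟨(i : ℕ) + 1, h⟩ < t i}

/-- The range of the variable following the variable `x`, the `j`-th one. -/
def nextRange (A : Finset ℕ) (j : ℕ) (x : ℝ) : Set ℝ :=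
  {s | s ∈ Set.Ioo (0 : ℝ) 1 ∧ if j ∈ A then x < s else s < x}

lemma mem_zigzag_succ {A : Finset ℕ} {n : ℕ} {t : Fin (n + 2) → ℝ} :
    t ∈ zigzag A (n + 2) ↔ Fin.init t ∈ zigzag A (n + 1) ∧
      t (Fin.last _) ∈ nextRange A (n + 1) (Fin.init t (Fin.last n)) := by
  constructor
  · rintro ⟨h1, h2⟩
    refine ⟨⟨fun j => h1 _, fun i h => ?_⟩, h1 _, ?_⟩
    · exact h2 i.castSucc (by simp only [Fin.val_castSucc]; omega)
    · exact h2 (Fin.last n).castSucc (by simp)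
  · rintro ⟨⟨h1, h2⟩, h3, h4⟩
    refine ⟨fun j => ?_, fun i h => ?_⟩
    · induction j using Fin.lastCases with
      | last => exact h3
      | cast j => exact h1 j
    · induction i using Fin.lastCases with
      | last => simp at h
      | cast i =>
        simp only [Fin.val_castSucc] at h ⊢
        rcases (Nat.le_of_lt_succ i.2).lt_or_eq with hi | hi
        · exact h2 i (by omega)
        · have : i = Fin.last n := Fin.ext hi
          subst this
          exact h4

lemma measurableSet_zigzag (A : Finset ℕ) (n : ℕ) : MeasurableSet (zigzag A n) := by
  unfold zigzag
  refine MeasurableSet.inter ?_ ?_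
  · show MeasurableSet {t : Fin n → ℝ | ∀ j, t j ∈ Set.Ioo (0 : ℝ) 1}
    simp only [Set.ofPred_forall]
    exact MeasurableSet.iInter fun j => measurable_pi_apply j measurableSet_Ioo
  · show MeasurableSet {t : Fin n → ℝ | ∀ (i : Fin n) (h : (i : ℕ) + 1 < n),
         if (i : ℕ) + 1 ∈ A then t i < t ⟨(i : ℕ) + 1, h⟩
         else t ⟨(i : ℕ) + 1, h⟩ < t i}
    simp only [Set.ofPred_forall]
    refine MeasurableSet.iInter fun i => MeasurableSet.iInter fun h => ?_
    split_ifs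
    · exact measurableSet_lt (measurable_pi_apply _) (measurable_pi_apply _)
    · exact measurableSet_lt (measurable_pi_apply _) (measurable_pi_apply _)

lemma zigzag_congr {A B : Finset ℕ} {n : ℕ} (h : ∀ j, 1 ≤ j → j < n → (j ∈ A ↔ j ∈ B)) :
    zigzag A n = zigzag B n := by
  ext t
  refine and_congr_right fun _ => forall_congr' fun i => forall_congr' fun hi => ?_
  simp only [h _ (Nat.le_add_left 1 i) hi]

/-- The iterated integral over `zigzag A (n + 1)` with weight `u i` at the `i`-th variable for
`i < n` and weight `g` at the last variable. -/
noncomputable def iterInt (A : Finset ℕ) (u : ℕ → ℝ → ℝ≥0∞) (n : ℕ) (g : ℝ → ℝ≥0∞) : ℝ≥0∞ :=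
  ∫⁻ t in zigzag A (n + 1), (∏ i : Fin n, u i (t i.castSucc)) * g (t (Fin.last n))

lemma iterInt_congr {A B : Finset ℕ} {u v : ℕ → ℝ → ℝ≥0∞} {n : ℕ} {f g : ℝ → ℝ≥0∞}
    (hAB : ∀ j, 1 ≤ j → j ≤ n → (j ∈ A ↔ j ∈ B)) (huv : ∀ j < n, u j = v j)
    (hfg : Set.EqOn f g (Set.Ioo 0 1)) : iterInt A u n f = iterInt B v n g := by
  rw [iterInt, iterInt, zigzag_congr fun j h1 h2 => hAB j h1 (Nat.le_of_lt_succ h2)]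
  refine setLIntegral_congr_fun (measurableSet_zigzag B _) fun t ht => ?_
  simp only [hfg (ht.1 (Fin.last n))]
  congr 1
  exact Finset.prod_congr rfl fun i _ => by rw [huv i i.2]

lemma iterInt_zero (A : Finset ℕ) (u : ℕ → ℝ → ℝ≥0∞) (g : ℝ → ℝ≥0∞) :
    iterInt A u 0 g = ∫⁻ s in Set.Ioo 0 1, g s := by
  have hmp := (volume_preserving_funUnique (Fin 1) ℝ)
  have h : zigzag A (0 + 1) = MeasurableEquiv.funUnique (Fin 1) ℝ ⁻¹' Set.Ioo 0 1 := by
    ext t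
    constructor
    · intro h
      exact h.1 0
    · intro h
      refine ⟨fun j => ?_, fun i hi => by omega⟩
      rw [Subsingleton.elim (α := Fin 1) j 0]
      exact h
  rw [iterInt, h, ← hmp.setLIntegral_comp_preimage_emb (MeasurableEquiv.measurableEmbedding _)]
  refine lintegral_congr fun t => ?_
  simp only [Finset.univ_eq_empty, Finset.prod_empty, one_mul]
  rfl

lemma iterInt_succ (A : Finset ℕ) {u : ℕ → ℝ → ℝ≥0∞} (hu : ∀ n, Measurable (u n)) (n : ℕ)
    {g : ℝ → ℝ≥0∞} (hg : Measurable g) :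
    iterInt A u (n + 1) g =
      iterInt A u n fun x => u n x * ∫⁻ s in nextRange A (n + 1) x, g s := by
  have hmp := (volume_preserving_piFinSuccAbove (fun _ : Fin (n + 2) => ℝ) (Fin.last (n + 1))).symm
  have hZ := measurableSet_zigzag A
  set f : (Fin (n + 2) → ℝ) → ℝ≥0∞ := fun t =>
    (∏ i : Fin (n + 1), u i (t i.castSucc)) * g (t (Fin.last (n + 1))) with hf
  have hfm : Measurable f := by
    refine Measurable.mul (Finset.measurable_prod _ fun i _ => ?_) ?_
    · exact (hu i).comp (measurable_pi_apply _)
    · exact hg.comp (measurable_pi_apply _)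
  have hfi : Measurable ((zigzag A (n + 2)).indicator f) := hfm.indicator (hZ _)
  have hsymm : ∀ (s : ℝ) (t : Fin (n + 1) → ℝ),
      (MeasurableEquiv.piFinSuccAbove (fun _ : Fin (n + 2) => ℝ) (Fin.last (n + 1))).symm (s, t)
        = Fin.snoc (α := fun _ => ℝ) t s := by
    intro s t
    rw [← Fin.insertNth_last']
    rfl
  rw [iterInt, iterInt, ← lintegral_indicator (hZ _), ← lintegral_indicator (hZ _),
    ← hmp.lintegral_comp hfi]
  refine (lintegral_prod_symm' _ (hfi.comp (MeasurableEquiv.measurable _))).trans ?_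
  refine lintegral_congr fun t => ?_
  have hS : MeasurableSet (nextRange A (n + 1) (t (Fin.last n))) := by
    refine MeasurableSet.inter measurableSet_Ioo ?_
    show MeasurableSet {s | if n + 1 ∈ A then t (Fin.last n) < s else s < t (Fin.last n)}
    split_ifs
    exacts [measurableSet_Ioi, measurableSet_Iio]
  have hfs : ∀ s, f (Fin.snoc (α := fun _ => ℝ) t s) =
      (∏ i : Fin n, u i (t i.castSucc)) * u n (t (Fin.last n)) * g s := by
    intro s
    simp only [hf, Fin.snoc_castSucc, Fin.snoc_last]
    rw [Fin.prod_univ_castSucc]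
    rfl
  by_cases ht : t ∈ zigzag A (n + 1)
  · rw [Set.indicator_of_mem ht]
    rw [← mul_assoc, ← lintegral_const_mul _ hg, ← lintegral_indicator hS]
    refine lintegral_congr fun s => ?_
    rw [Function.comp_apply, hsymm]
    by_cases hs : s ∈ nextRange A (n + 1) (t (Fin.last n))
    · rw [Set.indicator_of_mem hs, Set.indicator_of_mem, hfs]
      rw [mem_zigzag_succ]
      simpa using ⟨ht, hs⟩
    · rw [Set.indicator_of_notMem hs, Set.indicator_of_notMem]
      rw [mem_zigzag_succ]
      simpa using fun _ => hs
  · rw [Set.indicator_of_notMem ht]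
    rw [← lintegral_zero (μ := (volume : Measure ℝ))]
    refine lintegral_congr fun s => ?_
    rw [Function.comp_apply, hsymm]
    rw [Set.indicator_of_notMem]
    rw [mem_zigzag_succ]
    simpa using fun h => absurd h ht

/-- Iterated integration is integration of the last weight against a measure. -/
lemma exists_measure_iterInt (A : Finset ℕ) {u : ℕ → ℝ → ℝ≥0∞} (hu : ∀ n, Measurable (u n)) (n : ℕ) :
    ∃ μ : Measure ℝ, ∀ g : ℝ → ℝ≥0∞, Measurable g → ∫⁻ x, g x ∂μ = iterInt A u n g := by
  have hp : Measurable fun t : Fin (n + 1) → ℝ => ∏ i : Fin n, u i (t i.castSucc) :=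
    Finset.measurable_prod _ fun i _ => (hu i).comp (measurable_pi_apply _)
  refine ⟨((volume.restrict (zigzag A (n + 1))).withDensity
    fun t => ∏ i : Fin n, u i (t i.castSucc)).map fun t => t (Fin.last n), fun g hg => ?_⟩
  rw [lintegral_map hg (measurable_pi_apply _),
    lintegral_withDensity_eq_lintegral_mul _ hp 
      (g := fun t => g (t (Fin.last n))) (hg.comp (measurable_pi_apply _))]
  rfl

lemma setLIntegral_Ioo_eq_ofReal {f F : ℝ → ℝ} {a b : ℝ} (hab : a ≤ b)
    (hF : ∀ x ∈ Set.Icc a b, HasDerivAt F (f x) x) (hf : ContinuousOn f (Set.Icc a b))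
    (h0 : ∀ x ∈ Set.Ioo a b, 0 ≤ f x) :
    ∫⁻ x in Set.Ioo a b, ENNReal.ofReal (f x) = ENNReal.ofReal (F b - F a) := by
  have hi : IntervalIntegrable f volume a b := by
    refine ContinuousOn.intervalIntegrable ?_
    rwa [Set.uIcc_of_le hab]
  have := intervalIntegral.integral_eq_sub_of_hasDerivAt
    (fun x hx => hF x (by rwa [Set.uIcc_of_le hab] at hx)) hi
  rw [← this, intervalIntegral.integral_of_le hab, integral_Ioc_eq_integral_Ioo,
    ofReal_integral_eq_lintegral_ofReal]
  · exact ((intervalIntegrable_iff_integrableOn_Ioc_of_le hab).1 hi).mono_set Set.Ioo_subset_Ioc_self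
  · exact (ae_restrict_iff' measurableSet_Ioo).2 (Filter.Eventually.of_forall h0)

/-- The density of the form `ω` at the variable following `i` others. -/
noncomputable def formWeight (A : Finset ℕ) (i : ℕ) (x : ℝ) : ℝ :=
  if i + 1 ∈ A then 1 / (1 - x) else 1 / x

lemma measurable_formWeight (A : Finset ℕ) (i : ℕ) : Measurable (formWeight A i) := by
  unfold formWeight
  split_ifs <;> fun_prop

lemma nextRange_of_mem {A : Finset ℕ} {j : ℕ} (hj : j ∈ A) {x : ℝ} (hx : x ∈ Set.Ioo (0 : ℝ) 1) :
    nextRange A j x = Set.Ioo x 1 := by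
  ext s
  simp only [nextRange, hj, if_true, Set.mem_Ioo, Set.mem_ofPred_eq]
  exact ⟨fun h => ⟨h.2, h.1.2⟩, fun h => ⟨⟨hx.1.trans h.1, h.2⟩, h.1⟩⟩

lemma nextRange_of_notMem {A : Finset ℕ} {j : ℕ} (hj : j ∉ A) {x : ℝ}
    (hx : x ∈ Set.Ioo (0 : ℝ) 1) : nextRange A j x = Set.Ioo 0 x := by
  ext s
  simp only [nextRange, hj, if_false, Set.mem_Ioo, Set.mem_ofPred_eq]
  exact ⟨fun h => ⟨h.1.1, h.2⟩, fun h => ⟨⟨h.1, h.2.trans hx.2⟩, h.2⟩⟩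

lemma setLIntegral_one_sub_pow (n : ℕ) {a b : ℝ} (hab : a ≤ b) (hb : b ≤ 1) :
    ∫⁻ x in Set.Ioo a b, ENNReal.ofReal ((1 - x) ^ n) =
      ENNReal.ofReal (((1 - a) ^ (n + 1) - (1 - b) ^ (n + 1)) / ((n : ℝ) + 1)) := by
  have hn : (n : ℝ) + 1 ≠ 0 := by positivity
  rw [setLIntegral_Ioo_eq_ofReal (F := fun x => -(1 - x) ^ (n + 1) / ((n : ℝ) + 1)) hab]
  · congr 1
    ring
  · intro x _
    have := (((hasDerivAt_id x).const_sub 1).pow (n + 1)).neg.div_const ((n : ℝ) + 1)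
    refine this.congr_deriv ?_
    simp
    field_simp
  · fun_prop
  · intro x hx
    have : 0 ≤ 1 - x := by linarith [hx.2]
    positivity

lemma setLIntegral_log_pow (j : ℕ) {x : ℝ} (hx : x ∈ Set.Ioo (0 : ℝ) 1) :
    ∫⁻ s in Set.Ioo x 1, ENNReal.ofReal (1 / s) * ENNReal.ofReal ((-Real.log s) ^ j / j.factorial) =
      ENNReal.ofReal ((-Real.log x) ^ (j + 1) / (j + 1).factorial) := by
  have h1 : ∀ s ∈ Set.Ioo x 1, ENNReal.ofReal (1 / s) *
      ENNReal.ofReal ((-Real.log s) ^ j / j.factorial) =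
        ENNReal.ofReal (1 / s * ((-Real.log s) ^ j / j.factorial)) := by
    intro s hs
    have : 0 < s := hx.1.trans hs.1
    rw [ENNReal.ofReal_mul (by positivity)]
  have hne : ∀ s ∈ Set.Icc x 1, s ≠ 0 := fun s hs => (hx.1.trans_le hs.1).ne'
  rw [setLIntegral_congr_fun measurableSet_Ioo h1,
    setLIntegral_Ioo_eq_ofReal (F := fun s => -((-Real.log s) ^ (j + 1) / (j + 1).factorial)) hx.2.le]
  · simp
  · intro s hs
    have := ((((Real.hasDerivAt_log (hne s hs)).neg).pow (j + 1)).div_const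
      ((j + 1).factorial : ℝ)).neg
    refine this.congr_deriv ?_
    have h2 : (j.factorial : ℝ) ≠ 0 := by positivity
    have h3 := hne s hs
    rw [Nat.factorial_succ]
    push_cast
    simp
    field_simp
  · have hl : ContinuousOn Real.log (Set.Icc x 1) :=
      Real.continuousOn_log.mono fun s hs => hne s hs
    exact (continuousOn_const.div continuousOn_id hne).mul ((hl.neg.pow j).div_const _)
  · intro s hs
    have h2 : 0 < s := hx.1.trans hs.1
    have h3 : 0 ≤ -Real.log s := neg_nonneg.2 (Real.log_nonpos h2.le hs.2.le)
    positivity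

lemma starRec_nonneg (A : Finset ℕ) (N n : ℕ) : 0 ≤ starRec A N n := by
  induction N generalizing n with
  | zero => unfold starRec; positivity
  | succ N ih =>
    have := ih n
    have h2 := Finset.sum_nonneg fun j (_ : j ∈ Finset.range (n + 1)) => ih j
    unfold starRec
    split_ifs <;> positivity

lemma iterInt_one_sub_pow (A : Finset ℕ) (N n : ℕ) :
    iterInt A (fun i x => ENNReal.ofReal (formWeight A i x)) N
      (fun x => ENNReal.ofReal ((1 - x) ^ n)) = ENNReal.ofReal (starRec A N n) := by
  have hu : ∀ n, Measurable fun x => ENNReal.ofReal (formWeight A n x) :=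
    fun n => (measurable_formWeight A n).ennreal_ofReal
  have hm : ∀ n : ℕ, Measurable fun x : ℝ => ENNReal.ofReal ((1 - x) ^ n) := fun n => by fun_prop
  induction N generalizing n with
  | zero =>
    rw [iterInt_zero, setLIntegral_one_sub_pow n zero_le_one le_rfl, starRec]
    simp
  | succ N ih =>
    rw [iterInt_succ A hu N (hm n), starRec]
    obtain ⟨μ, hμ⟩ := exists_measure_iterInt A hu N
    have hc : (0 : ℝ) ≤ 1 / ((n : ℝ) + 1) := by positivity
    split_ifs with hA
    · rw [iterInt_congr (fun _ _ _ => Iff.rfl) (fun _ _ => rfl)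
        (g := fun x => ENNReal.ofReal (1 / ((n : ℝ) + 1)) * ENNReal.ofReal ((1 - x) ^ n)),
        ← hμ _ ((hm n).const_mul _), lintegral_const_mul _ (hm n), hμ _ (hm n), ih,
        ← ENNReal.ofReal_mul hc]
      · congr 1
        ring
      · intro x hx
        have h1 : 0 < 1 - x := by linarith [hx.2]
        dsimp only
        rw [nextRange_of_mem hA hx, setLIntegral_one_sub_pow n hx.2.le le_rfl, formWeight, if_pos hA,
          ← ENNReal.ofReal_mul (by positivity), ← ENNReal.ofReal_mul hc]
        congr 1
        simp
        field_simp
        ring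
    · rw [iterInt_congr (fun _ _ _ => Iff.rfl) (fun _ _ => rfl)
        (g := fun x => ENNReal.ofReal (1 / ((n : ℝ) + 1)) *
          ∑ j ∈ Finset.range (n + 1), ENNReal.ofReal ((1 - x) ^ j)),
        ← hμ _ ((Finset.measurable_fun_sum _ fun j _ => hm j).const_mul _),
        lintegral_const_mul _ (Finset.measurable_fun_sum _ fun j _ => hm j),
        lintegral_finsetSum _ fun j _ => hm j]
      · simp_rw [hμ _ (hm _), ih]
        rw [← ENNReal.ofReal_sum_of_nonneg fun j _ => starRec_nonneg A N j,
          ← ENNReal.ofReal_mul hc]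
        congr 1
        ring
      · intro x hx
        have h1 : 0 ≤ 1 - x := by linarith [hx.2]
        have h2 : 0 < x := hx.1
        dsimp only
        rw [nextRange_of_notMem hA hx, setLIntegral_one_sub_pow n hx.1.le hx.2.le, formWeight,
          if_neg hA, ← ENNReal.ofReal_mul (by positivity),
          ← ENNReal.ofReal_sum_of_nonneg fun j _ => pow_nonneg h1 j, ← ENNReal.ofReal_mul hc,
          geom_sum_eq (by linarith)]
        congr 1
        have h3 : 1 - x - 1 = -x := by ring
        rw [h3]
        simp
        field_simp
        ring

lemma iterInt_log_pow (A : Finset ℕ) {u : ℕ → ℝ → ℝ≥0∞} (hu : ∀ n, Measurable (u n)) (N m j : ℕ)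
    (hA : ∀ i, N < i → i ≤ N + m → i ∈ A)
    (hu' : ∀ i, N < i → i ≤ N + m → u i = fun x => ENNReal.ofReal (1 / x)) :
    iterInt A u (N + m) (fun x => u (N + m) x * ENNReal.ofReal ((-Real.log x) ^ j / j.factorial)) =
      iterInt A u N fun x =>
        u N x * ENNReal.ofReal ((-Real.log x) ^ (m + j) / (m + j).factorial) := by
  induction m generalizing j with
  | zero => simp
  | succ m ih =>
    have hm : Measurable fun x : ℝ => ENNReal.ofReal ((-Real.log x) ^ j / j.factorial) := by
      have := Real.measurable_log
      fun_prop
    rw [← add_assoc, iterInt_succ A hu _ (g := fun x => u (N + m + 1) x *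
      ENNReal.ofReal ((-Real.log x) ^ j / j.factorial)) ((hu _).mul hm)]
    have h := ih (j + 1) (fun i h1 h2 => hA i h1 (by omega)) (fun i h1 h2 => hu' i h1 (by omega))
    rw [add_right_comm m 1 j, add_assoc m j 1, ← h]
    refine iterInt_congr (fun _ _ _ => Iff.rfl) (fun _ _ => rfl) fun x hx => ?_
    rw [nextRange_of_mem (hA _ (by omega) (by omega)) hx, hu' (N + m + 1) (by omega) (by omega),
      setLIntegral_log_pow j hx]

lemma setIntegral_zigzag_eq_iterInt (A : Finset ℕ) {n M : ℕ} (hn : n = M + 1) {φ : ℕ → ℝ → ℝ}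
    (hφ : ∀ i, Measurable (φ i)) (h0 : ∀ i, ∀ x ∈ Set.Ioo (0 : ℝ) 1, 0 ≤ φ i x) :
    ∫ t in zigzag A n, ∏ i : Fin n, φ i (t i) =
      (iterInt A (fun i x => ENNReal.ofReal (φ i x)) M fun x => ENNReal.ofReal (φ M x)).toReal := by
  subst hn
  rw [integral_eq_lintegral_of_nonneg_ae]
  · rw [iterInt]
    congr 1
    refine setLIntegral_congr_fun (measurableSet_zigzag A _) fun t ht => ?_
    rw [ENNReal.ofReal_prod_of_nonneg fun (i : Fin (M + 1)) _ => h0 i _ (ht.1 i), Fin.prod_univ_castSucc]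
    rfl
  · exact (ae_restrict_iff' (measurableSet_zigzag A _)).2 (Filter.Eventually.of_forall fun t ht =>
      Finset.prod_nonneg fun (i : Fin (M + 1)) _ => h0 i _ (ht.1 i))
  · have : Measurable fun t : Fin (M + 1) → ℝ => ∏ i : Fin (M + 1), φ i (t i) :=
      Finset.measurable_fun_prod _ fun i _ => (hφ i).comp (measurable_pi_apply i)
    exact this.aestronglyMeasurable

lemma Aint_eq_iterInt {k : List ℕ} (hk : k ≠ []) {N : ℕ}
    (hN : k.sum = N + 1) {m : ℕ} (hm : 0 < m) :
    Aint k m = (iterInt (Aset k) (fun i x => ENNReal.ofReal (formWeight (Aset k) i x)) N fun x =>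
      ENNReal.ofReal (1 / (1 - x)) *
        ENNReal.ofReal ((-Real.log x) ^ m / m.factorial)).toReal := by
  set B := Aset (k ++ List.replicate m 1) with hB
  have hne : List.replicate m 1 ≠ [] := by simpa using hm.ne'
  have hrep : ∀ j, j ∈ Aset (List.replicate m 1) ↔ 1 ≤ j ∧ j < m := by
    intro j
    rw [mem_Aset]
    constructor
    · rintro ⟨i, h1, h2, rfl⟩
      simp at h2 ⊢
      omega
    · rintro ⟨h1, h2⟩
      refine ⟨j, h1, by simpa using h2, ?_⟩
      simp
      omega
  have hBmem : ∀ j, j ∈ B ↔ j ∈ Aset k ∨ (N + 1 ≤ j ∧ j ≤ N + m) := by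
    intro j
    rw [hB, mem_Aset_append hk hne, hN]
    refine or_congr_right ⟨?_, fun h => ?_⟩
    · rintro (rfl | ⟨i, hi, rfl⟩)
      · omega
      · rw [hrep] at hi
        omega
    · rcases h.1.eq_or_lt with h' | h'
      · exact Or.inl h'.symm
      · exact Or.inr ⟨j - (N + 1), (hrep _).2 (by omega), by omega⟩
  set φ : ℕ → ℝ → ℝ := fun i x =>
    if i + 1 < k.sum then (if i + 1 ∈ Aset k then 1 / (1 - x) else 1 / x)
      else if i + 1 = k.sum then 1 / (1 - x) else 1 / x with hφ
  have hφm : ∀ i, Measurable (φ i) := by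
    intro i
    simp only [hφ]
    split_ifs <;> fun_prop
  have hφ0 : ∀ i, ∀ x ∈ Set.Ioo (0 : ℝ) 1, 0 ≤ φ i x := by
    intro i x hx
    have h1 : 0 ≤ 1 - x := by linarith [hx.2]
    have h2 : 0 ≤ x := hx.1.le
    simp only [hφ]
    split_ifs <;> positivity
  have hsum : (k ++ List.replicate m 1).sum = N + m + 1 := by
    simp [hN]; omega
  have h1 : Aint k m = ∫ t in zigzag B (k ++ List.replicate m 1).sum,
      ∏ i : Fin (k ++ List.replicate m 1).sum, φ i (t i) := rfl
  have h2 := iterInt_log_pow B (u := fun i x => ENNReal.ofReal (φ i x))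
    (fun i => (hφm i).ennreal_ofReal) N m 0 (fun i h1 h2 => (hBmem i).2 (Or.inr ⟨h1, h2⟩))
    (fun i h1 h2 => by
      ext x
      simp only [hφ]
      rw [if_neg (by omega), if_neg (by omega)])
  simp only [pow_zero, Nat.factorial_zero, Nat.cast_one, div_one, ENNReal.ofReal_one, mul_one,
    add_zero] at h2
  rw [h1, setIntegral_zigzag_eq_iterInt B hsum hφm hφ0, h2]
  congr 1
  refine iterInt_congr (fun j h1 h2 => ?_) (fun j hj => ?_) fun x _ => ?_
  · rw [hBmem, or_iff_left (by omega)]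
  · ext x
    simp only [hφ, formWeight]
    rw [if_pos (by omega)]
  · simp only [hφ]
    rw [if_neg (by omega), if_pos hN.symm]

/-! ### Growth of the coefficients -/

lemma sum_inv_sqrt_le (n : ℕ) :
    ∑ j ∈ Finset.range n, 1 / √((j : ℝ) + 1) ≤ 2 * √(n : ℝ) := by
  induction n with
  | zero => simp
  | succ n ih =>
    rw [Finset.sum_range_succ]
    have h1 : 0 < √((n : ℝ) + 1) := Real.sqrt_pos.2 (by positivity)
    have h2 := Real.sqrt_nonneg (n : ℝ)
    have h3 : √((n : ℝ) + 1) ^ 2 = n + 1 := Real.sq_sqrt (by positivity)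
    have h4 : √(n : ℝ) ^ 2 = n := Real.sq_sqrt (by positivity)
    have h5 : 1 / √((n : ℝ) + 1) ≤ 2 * √((n : ℝ) + 1) - 2 * √(n : ℝ) := by
      rw [div_le_iff₀ h1]
      nlinarith [sq_nonneg (√((n : ℝ) + 1) - √(n : ℝ))]
    push_cast
    linarith

lemma starRec_le (A : Finset ℕ) (N n : ℕ) : starRec A N n ≤ 2 ^ N * (1 / √((n : ℝ) + 1)) := by
  induction N generalizing n with
  | zero =>
    rw [starRec, pow_zero, one_mul]
    gcongr
    rw [Real.sqrt_le_left (by positivity)]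
    have : (0 : ℝ) ≤ n := by positivity
    nlinarith
  | succ N ih =>
    have hn : (0 : ℝ) < (n : ℝ) + 1 := by positivity
    have hs : 0 < √((n : ℝ) + 1) := Real.sqrt_pos.2 hn
    have h3 : √((n : ℝ) + 1) ^ 2 = n + 1 := Real.sq_sqrt hn.le
    rw [starRec]
    split_ifs
    · calc starRec A N n / ((n : ℝ) + 1) ≤ starRec A N n :=
            div_le_self (starRec_nonneg A N n) (by linarith [(Nat.cast_nonneg n : (0 : ℝ) ≤ n)])
        _ ≤ 2 ^ N * (1 / √((n : ℝ) + 1)) := ih n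
        _ ≤ 2 ^ (N + 1) * (1 / √((n : ℝ) + 1)) := by
            gcongr
            · norm_num
            · omega
    · rw [div_le_iff₀ hn]
      calc ∑ j ∈ Finset.range (n + 1), starRec A N j
          ≤ ∑ j ∈ Finset.range (n + 1), 2 ^ N * (1 / √((j : ℝ) + 1)) :=
            Finset.sum_le_sum fun j _ => ih j
        _ ≤ 2 ^ N * (2 * √((n : ℝ) + 1)) := by
            rw [← Finset.mul_sum]
            gcongr
            have := sum_inv_sqrt_le (n + 1)
            push_cast at this
            exact this
        _ = 2 ^ (N + 1) * (1 / √((n : ℝ) + 1)) * ((n : ℝ) + 1) := by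
            have e : 1 / √((n : ℝ) + 1) * ((n : ℝ) + 1) = √((n : ℝ) + 1) := by
              rw [div_mul_eq_mul_div, one_mul, div_eq_iff hs.ne', ← sq, h3]
            rw [mul_assoc _ (1 / _), e]
            ring

lemma cbinom_succ (z : ℂ) (n : ℕ) : cbinom z (n + 1) = cbinom z n * ((z - n) / (n + 1)) := by
  have h : (n.factorial : ℂ) ≠ 0 := by exact_mod_cast n.factorial_ne_zero
  have h' : (n : ℂ) + 1 ≠ 0 := by exact_mod_cast n.succ_ne_zero
  simp only [cbinom, descPochhammer_eval_eq_prod_range, Finset.prod_range_succ, Nat.factorial_succ]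
  push_cast
  field_simp

lemma cbinom_zero (z : ℂ) : cbinom z 0 = 1 := by
  simp [cbinom]

/-- The absolute value of the binomial coefficient `binom(-1/8, n)`. -/
noncomputable def absBinom (n : ℕ) : ℝ :=
  ∏ j ∈ Finset.range n, ((1 / 8 + (j : ℝ)) / ((j : ℝ) + 1))

lemma absBinom_nonneg (n : ℕ) : 0 ≤ absBinom n :=
  Finset.prod_nonneg fun _ _ => by positivity

lemma cbinom_neg_eighth (n : ℕ) : cbinom (-(1 / 8)) n = (-1) ^ n * (absBinom n : ℂ) := by
  induction n with
  | zero => simp [cbinom_zero, absBinom]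
  | succ n ih =>
    rw [cbinom_succ, ih, absBinom, absBinom, Finset.prod_range_succ]
    push_cast
    ring

lemma norm_cbinom_le {z : ℂ} (hz : ‖z‖ ≤ 1 / 8) (n : ℕ) : ‖cbinom z n‖ ≤ absBinom n := by
  induction n with
  | zero => simp [cbinom_zero, absBinom]
  | succ n ih =>
    rw [cbinom_succ, absBinom, Finset.prod_range_succ, norm_mul, norm_div]
    have h1 : ‖(n : ℂ) + 1‖ = (n : ℝ) + 1 := by
      rw [← Nat.cast_succ, Complex.norm_natCast]
      simp
    have h2 : ‖z - n‖ ≤ 1 / 8 + (n : ℝ) := by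
      calc ‖z - n‖ ≤ ‖z‖ + ‖(n : ℂ)‖ := norm_sub_le _ _
        _ ≤ _ := by rw [Complex.norm_natCast]; gcongr
    rw [h1]
    exact mul_le_mul ih (by gcongr) (by positivity) (absBinom_nonneg n)

lemma absBinom_succ_le (n : ℕ) : absBinom (n + 1) ≤ ((n : ℝ) + 1) ^ (1 / 4 : ℝ) / ((n : ℝ) + 1) := by
  induction n with
  | zero => norm_num [absBinom]
  | succ n ih =>
    rw [absBinom, Finset.prod_range_succ, ← absBinom]
    push_cast
    set x : ℝ := (n : ℝ) + 1 with hx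
    have hx1 : 1 ≤ x := by linarith [(Nat.cast_nonneg n : (0 : ℝ) ≤ n)]
    have hx0 : 0 < x := by linarith
    have key : x ^ (1 / 4 : ℝ) * ((1 / 8 + x) / x) ≤ (x + 1) ^ (1 / 4 : ℝ) := by
      refine le_of_pow_le_pow_left₀ (n := 4) (by norm_num) (by positivity) ?_
      have e : ∀ y : ℝ, 0 ≤ y → (y ^ (1 / 4 : ℝ)) ^ 4 = y := by
        intro y hy
        rw [← Real.rpow_natCast, ← Real.rpow_mul hy]
        norm_num
      rw [mul_pow, e x hx0.le, e (x + 1) (by linarith), div_pow, mul_div_assoc',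
        div_le_iff₀ (by positivity)]
      nlinarith [pow_pos hx0 2, pow_pos hx0 3, pow_pos hx0 4, mul_nonneg hx0.le (sub_nonneg.2 hx1),
        mul_nonneg (pow_pos hx0 2).le (sub_nonneg.2 hx1),
        mul_nonneg (pow_pos hx0 3).le (sub_nonneg.2 hx1)]
    calc absBinom (n + 1) * ((1 / 8 + x) / (x + 1))
        ≤ x ^ (1 / 4 : ℝ) / x * ((1 / 8 + x) / (x + 1)) := by gcongr
      _ = x ^ (1 / 4 : ℝ) * ((1 / 8 + x) / x) / (x + 1) := by field_simp
      _ ≤ (x + 1) ^ (1 / 4 : ℝ) / (x + 1) := by gcongr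

lemma summable_absBinom_mul_starRec (A : Finset ℕ) (N : ℕ) :
    Summable fun n => absBinom (n + 1) * starRec A N n := by
  have h : Summable fun n : ℕ => 2 ^ N * (((n + 1 : ℕ) : ℝ) ^ (-(5 / 4) : ℝ)) :=
    ((summable_nat_add_iff 1).2 (Real.summable_nat_rpow.2 (by norm_num))).mul_left _
  refine Summable.of_nonneg_of_le
    (fun n => mul_nonneg (absBinom_nonneg _) (starRec_nonneg A N n)) (fun n => ?_) h
  have hn : (0 : ℝ) < (n : ℝ) + 1 := by positivity
  calc absBinom (n + 1) * starRec A N n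
      ≤ (((n : ℝ) + 1) ^ (1 / 4 : ℝ) / ((n : ℝ) + 1)) * (2 ^ N * (1 / √((n : ℝ) + 1))) :=
        mul_le_mul (absBinom_succ_le n) (starRec_le A N n) (starRec_nonneg A N n) (by positivity)
    _ = 2 ^ N * (((n + 1 : ℕ) : ℝ) ^ (-(5 / 4) : ℝ)) := by
        have e : ((n : ℝ) + 1) ^ (-(5 / 4) : ℝ) =
            ((n : ℝ) + 1) ^ (1 / 4 : ℝ) / ((n : ℝ) + 1) / ((n : ℝ) + 1) ^ (1 / 2 : ℝ) := by
          rw [← Real.rpow_sub_one hn.ne', ← Real.rpow_sub hn]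
          norm_num
        push_cast
        rw [e, Real.sqrt_eq_rpow]
        ring

/-! ### Two expansions of `(1 - t ^ z) / (1 - t)` -/

lemma choose_eq_cbinom (z : ℂ) (n : ℕ) : Ring.choose z n = cbinom z n := by
  rw [Ring.choose_eq_smul, Polynomial.descPochhammer_smeval_eq_ascPochhammer,
    Polynomial.ascPochhammer_smeval_cast, Polynomial.ascPochhammer_smeval_eq_eval, cbinom,
    descPochhammer_eval_eq_ascPochhammer, smul_eq_mul, div_eq_inv_mul]

lemma hasSum_cbinom (z : ℂ) {t : ℝ} (ht : t ∈ Set.Ioo (0 : ℝ) 1) :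
    HasSum (fun n : ℕ => (-1 : ℂ) ^ n * cbinom z (n + 1) * (((1 - t) ^ n : ℝ) : ℂ))
      ((1 - (t : ℂ) ^ z) / (1 - (t : ℂ))) := by
  have hu' : (1 - (t : ℂ)) ≠ 0 := by
    rw [sub_ne_zero]
    exact_mod_cast ht.2.ne'
  have hball : (t : ℂ) - 1 ∈ Metric.eball (0 : ℂ) 1 := by
    rw [← ENNReal.ofReal_one, Metric.eball_ofReal, mem_ball_zero_iff, ← Complex.ofReal_one,
      ← Complex.ofReal_sub, Complex.norm_real, Real.norm_eq_abs, abs_lt]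
    constructor <;> linarith [ht.1, ht.2]
  have h := (Complex.one_add_cpow_hasFPowerSeriesOnBall_zero (a := z)).hasSum hball
  simp only [binomialSeries_apply, List.ofFn_const, List.prod_replicate, choose_eq_cbinom,
    smul_eq_mul, zero_add, add_sub_cancel] at h
  have h2 := ((hasSum_nat_add_iff' 1).2 h).mul_left (-(1 - (t : ℂ))⁻¹)
  simp only [Finset.range_one, Finset.sum_singleton, cbinom_zero, pow_zero, mul_one] at h2
  have e : (1 - (t : ℂ) ^ z) / (1 - (t : ℂ)) = -(1 - (t : ℂ))⁻¹ * ((t : ℂ) ^ z - 1) := by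
    rw [div_eq_mul_inv]
    ring
  rw [e]
  refine h2.congr_fun fun n => ?_
  have : (t : ℂ) - 1 = -1 * (1 - t) := by ring
  rw [this, mul_pow]
  push_cast
  field_simp
  ring

lemma hasSum_log_pow (z : ℂ) {t : ℝ} (ht : t ∈ Set.Ioo (0 : ℝ) 1) :
    HasSum (fun m : ℕ => (-1 : ℂ) ^ m * z ^ (m + 1) *
      ((1 / (1 - t) * ((-Real.log t) ^ (m + 1) / (m + 1).factorial) : ℝ) : ℂ))
      ((1 - (t : ℂ) ^ z) / (1 - (t : ℂ))) := by
  have hu' : (1 - (t : ℂ)) ≠ 0 := by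
    rw [sub_ne_zero]
    exact_mod_cast ht.2.ne'
  have ht0 : (t : ℂ) ≠ 0 := by exact_mod_cast ht.1.ne'
  have h := NormedSpace.expSeries_div_hasSum_exp (-z * ((-Real.log t : ℝ) : ℂ))
  have he : NormedSpace.exp (-z * ((-Real.log t : ℝ) : ℂ)) = (t : ℂ) ^ z := by
    rw [← Complex.exp_eq_exp_ℂ, Complex.cpow_def_of_ne_zero ht0, ← Complex.ofReal_log ht.1.le]
    congr 1
    push_cast
    ring
  rw [he] at h
  have h2 := ((hasSum_nat_add_iff' 1).2 h).mul_left (-(1 - (t : ℂ))⁻¹)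
  simp only [Finset.range_one, Finset.sum_singleton, pow_zero, Nat.factorial_zero, Nat.cast_one,
    div_one] at h2
  have e : (1 - (t : ℂ) ^ z) / (1 - (t : ℂ)) = -(1 - (t : ℂ))⁻¹ * ((t : ℂ) ^ z - 1) := by
    rw [div_eq_mul_inv]
    ring
  rw [e]
  refine h2.congr_fun fun n => ?_
  rw [mul_pow, neg_pow z]
  push_cast
  field_simp
  ring

/-! ### Termwise integration -/

lemma tsum_mul_toReal_lintegral {μ : Measure ℝ} {c : ℕ → ℂ} {w : ℕ → ℝ → ℝ} {S : ℝ → ℂ}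
    (hw : ∀ n, Measurable (w n)) (hw0 : ∀ n, ∀ᵐ t ∂μ, 0 ≤ w n t)
    (hfin : ∑' n, ‖c n‖ₑ * ∫⁻ t, ENNReal.ofReal (w n t) ∂μ ≠ ⊤)
    (hS : ∀ᵐ t ∂μ, HasSum (fun n => c n * (w n t : ℂ)) (S t)) :
    ∑' n, c n * (((∫⁻ t, ENNReal.ofReal (w n t) ∂μ).toReal : ℝ) : ℂ) = ∫ t, S t ∂μ := by
  have hmeas : ∀ n, Measurable fun t => c n * (w n t : ℂ) := fun n =>
    (Complex.measurable_ofReal.comp (hw n)).const_mul _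
  have hnorm : ∀ n, ∫⁻ t, ‖c n * (w n t : ℂ)‖ₑ ∂μ =
      ‖c n‖ₑ * ∫⁻ t, ENNReal.ofReal (w n t) ∂μ := by
    intro n
    rw [← lintegral_const_mul _ (hw n).ennreal_ofReal]
    refine lintegral_congr_ae ((hw0 n).mono fun t ht => ?_)
    simp only [enorm_mul]
    rw [← ofReal_norm (w n t : ℂ), Complex.norm_real, Real.norm_of_nonneg ht]
  have h := integral_tsum (μ := μ) (fun n => (hmeas n).aestronglyMeasurable) (by simpa only [hnorm] using hfin)
  rw [← integral_congr_ae (hS.mono fun t ht => ht.tsum_eq), h]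
  refine tsum_congr fun n => ?_
  rw [integral_const_mul, integral_complex_ofReal,
    integral_eq_lintegral_of_nonneg_ae (hw0 n) (hw n).aestronglyMeasurable]

lemma exists_measure_Ioo (A : Finset ℕ) (N : ℕ) :
    ∃ μ : Measure ℝ, (∀ᵐ t ∂μ, t ∈ Set.Ioo (0 : ℝ) 1) ∧ ∀ g, Measurable g →
      ∫⁻ x, g x ∂μ = iterInt A (fun i x => ENNReal.ofReal (formWeight A i x)) N g := by
  obtain ⟨μ, hμ⟩ := exists_measure_iterInt A
    (u := fun i x => ENNReal.ofReal (formWeight A i x))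
    (fun i => (measurable_formWeight A i).ennreal_ofReal) N
  refine ⟨μ, ?_, hμ⟩
  have h0 : iterInt A (fun i x => ENNReal.ofReal (formWeight A i x)) N (fun _ => 0) = 0 := by
    rw [← hμ _ measurable_const, lintegral_zero]
  have h1 : ∫⁻ x, (Set.Ioo (0 : ℝ) 1)ᶜ.indicator (fun _ => 1) x ∂μ = 0 := by
    rw [hμ _ (measurable_const.indicator measurableSet_Ioo.compl),
      iterInt_congr (g := fun _ => 0) (fun _ _ _ => Iff.rfl) (fun _ _ => rfl)
        (fun x hx => Set.indicator_of_notMem (Set.notMem_compl_iff.2 hx) _), h0]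
  rw [lintegral_indicator measurableSet_Ioo.compl] at h1
  rw [setLIntegral_one] at h1
  exact mem_ae_iff.2 h1

lemma tsum_geometric_eq_tsum_absBinom {t : ℝ} (ht : t ∈ Set.Ioo (0 : ℝ) 1) :
    ∑' m : ℕ, ENNReal.ofReal ((1 / 8) ^ (m + 1) *
        (1 / (1 - t) * ((-Real.log t) ^ (m + 1) / (m + 1).factorial))) =
      ∑' n : ℕ, ENNReal.ofReal (absBinom (n + 1) * (1 - t) ^ n) := by
  have hl : 0 ≤ -Real.log t := by linarith [Real.log_nonpos ht.1.le ht.2.le]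
  have h1t : 0 ≤ 1 - t := by linarith [ht.2]
  have h1 := (Complex.hasSum_re (hasSum_cbinom (-(1 / 8)) ht)).neg
  have h2 := (Complex.hasSum_re (hasSum_log_pow (-(1 / 8)) ht)).neg
  have h1' : HasSum (fun n : ℕ => absBinom (n + 1) * (1 - t) ^ n) _ :=
    h1.congr_fun fun n => by
      rw [cbinom_neg_eighth, ← mul_assoc, ← pow_add, ← add_assoc, Odd.neg_one_pow ⟨n, by ring⟩,
        mul_assoc, ← Complex.ofReal_mul, neg_one_mul, Complex.neg_re, Complex.ofReal_re,
        neg_neg]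
  have h2' : HasSum (fun m : ℕ => (1 / 8) ^ (m + 1) *
        (1 / (1 - t) * ((-Real.log t) ^ (m + 1) / (m + 1).factorial))) _ :=
    h2.congr_fun fun m => by
      rw [neg_pow (1 / 8 : ℂ), ← mul_assoc ((-1 : ℂ) ^ m), ← pow_add, ← add_assoc, Odd.neg_one_pow ⟨m, by ring⟩,
        mul_assoc, neg_one_mul, Complex.neg_re, neg_neg,
        show (1 / 8 : ℂ) = ((1 / 8 : ℝ) : ℂ) by push_cast; rfl, ← Complex.ofReal_pow,
        ← Complex.ofReal_mul, Complex.ofReal_re]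
  rw [← ENNReal.ofReal_tsum_of_nonneg (fun n => by positivity) h2'.summable,
    ← ENNReal.ofReal_tsum_of_nonneg
      (fun n => mul_nonneg (absBinom_nonneg _) (by positivity)) h1'.summable,
    h1'.tsum_eq, h2'.tsum_eq]

lemma enorm_le_ofReal {E : Type*} [SeminormedAddCommGroup E] {x : E} {r : ℝ} (h : ‖x‖ ≤ r) :
    ‖x‖ₑ ≤ ENNReal.ofReal r := by
  rw [← ofReal_norm]
  exact ENNReal.ofReal_le_ofReal h

/-- Taylor expansion (second form): near `z = 0`,
`F_k(z) = Σ_{m=1}^∞ (-1)^{m-1} A_m(k) z^m`. -/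
theorem F_taylor_two (k : List ℕ) (hk : k ≠ []) (hpos : ∀ x ∈ k, 0 < x) :
    ∀ᶠ z : ℂ in 𝓝 0,
      F k z = ∑' m : ℕ, (-1 : ℂ) ^ m * ((Aint k (m + 1) : ℝ) : ℂ) * z ^ (m + 1) := by
  have hsum : 0 < k.sum := List.sum_pos k hpos hk
  obtain ⟨N, hN⟩ : ∃ N, k.sum = N + 1 := ⟨k.sum - 1, by omega⟩
  obtain ⟨μ, hIoo, hμ⟩ := exists_measure_Ioo (Aset k) N
  have hw1 : ∀ n : ℕ, Measurable fun t : ℝ => (1 - t) ^ n := fun n => by fun_prop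
  have hw2 : ∀ m : ℕ, Measurable fun t : ℝ =>
      1 / (1 - t) * ((-Real.log t) ^ (m + 1) / (m + 1).factorial) := fun m => by fun_prop
  have hw1' : ∀ n : ℕ, ∀ᵐ t ∂μ, 0 ≤ (1 - t) ^ n := fun n =>
    hIoo.mono fun t ht => pow_nonneg (by linarith [ht.2]) n
  have hw2' : ∀ m : ℕ, ∀ᵐ t ∂μ,
      0 ≤ 1 / (1 - t) * ((-Real.log t) ^ (m + 1) / (m + 1).factorial) := fun m =>
    hIoo.mono fun t ht => by
      have hl : 0 ≤ -Real.log t := by linarith [Real.log_nonpos ht.1.le ht.2.le]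
      have h1t : 0 ≤ 1 - t := by linarith [ht.2]
      positivity
  have hI1 : ∀ n : ℕ, ∫⁻ t, ENNReal.ofReal ((1 - t) ^ n) ∂μ =
      ENNReal.ofReal (starRec (Aset k) N n) := fun n => by
    rw [hμ _ (hw1 n).ennreal_ofReal, iterInt_one_sub_pow]
  have hI2 : ∀ m : ℕ, (∫⁻ t, ENNReal.ofReal
      (1 / (1 - t) * ((-Real.log t) ^ (m + 1) / (m + 1).factorial)) ∂μ).toReal =
      Aint k (m + 1) := fun m => by
    rw [Aint_eq_iterInt hk hN m.succ_pos, ← hμ _ (by fun_prop)]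
    refine congrArg _ (lintegral_congr_ae (hIoo.mono fun t ht => ?_))
    exact ENNReal.ofReal_mul (one_div_nonneg.2 (by linarith [ht.2]))
  have hB : ∑' n : ℕ, ENNReal.ofReal (absBinom (n + 1)) *
      ∫⁻ t, ENNReal.ofReal ((1 - t) ^ n) ∂μ ≠ ⊤ := by
    simp only [hI1, ← ENNReal.ofReal_mul (absBinom_nonneg _)]
    exact (summable_absBinom_mul_starRec (Aset k) N).tsum_ofReal_ne_top
  have hB' : ∑' m : ℕ, ENNReal.ofReal ((1 / 8) ^ (m + 1)) * ∫⁻ t, ENNReal.ofReal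
      (1 / (1 - t) * ((-Real.log t) ^ (m + 1) / (m + 1).factorial)) ∂μ ≠ ⊤ := by
    convert hB using 1
    simp only [← lintegral_const_mul _ (hw1 _).ennreal_ofReal,
      ← lintegral_const_mul _ (hw2 _).ennreal_ofReal,
      ← ENNReal.ofReal_mul (absBinom_nonneg _),
      ← ENNReal.ofReal_mul (pow_nonneg (by norm_num : (0 : ℝ) ≤ 1 / 8) _)]
    rw [← lintegral_tsum fun n => ((hw1 n).const_mul _).ennreal_ofReal.aemeasurable,
      ← lintegral_tsum fun m => ((hw2 m).const_mul _).ennreal_ofReal.aemeasurable]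
    exact lintegral_congr_ae (hIoo.mono fun t ht => tsum_geometric_eq_tsum_absBinom ht)
  filter_upwards [Metric.closedBall_mem_nhds (0 : ℂ) (by norm_num : (0 : ℝ) < 1 / 8)] with z hz
  rw [mem_closedBall_zero_iff] at hz
  have h1 := tsum_mul_toReal_lintegral (c := fun n => (-1) ^ n * cbinom z (n + 1)) hw1 hw1'
    (ne_top_of_le_ne_top hB <| ENNReal.tsum_le_tsum fun n => by
      gcongr
      refine enorm_le_ofReal ?_
      simpa using norm_cbinom_le hz (n + 1))
    (hIoo.mono fun t ht => hasSum_cbinom z ht)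
  have h2 := tsum_mul_toReal_lintegral (c := fun m => (-1) ^ m * z ^ (m + 1)) hw2 hw2'
    (ne_top_of_le_ne_top hB' <| ENNReal.tsum_le_tsum fun m => by
      gcongr
      refine enorm_le_ofReal ?_
      rw [norm_mul, norm_pow, norm_neg, norm_one, one_pow, one_mul, norm_pow]
      gcongr)
    (hIoo.mono fun t ht => hasSum_log_pow z ht)
  simp only [hI1, hI2, ENNReal.toReal_ofReal (starRec_nonneg _ _ _)] at h1 h2
  rw [F, if_neg hk]
  calc _ = _ := tsum_congr fun n => by rw [sStar_hdual hsum, hN, Nat.add_sub_cancel]; ring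
    _ = _ := h1.trans h2.symm
    _ = _ := tsum_congr fun m => by ring

end Kawashima
end

section
/- Let k=(k_1,…,k_r) be a nonempty index and m≥1 an integer. Then the m-th derivative of G_k at z=0 satisfies G_k^{(m)}(0)/m! = (−1)^{m−1} C_m(k), where C_m(k) = Σ ζ_k(1,…,1 (k_1−1 ones), l_1+1, …, 1,…,1 (k_r−1 ones), l_r+1), the sum being over all integers l_1,…,l_{r−1}≥0 and l_r≥1 with l_1+⋯+l_r=m. -/
open MeasureTheory Filter Topology

namespace Kawashima

theorem hasSum_iteratedDeriv_of_summable_norm {ι : Type*} {f : ι → ℂ → ℂ} {u : ι → ℝ}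
    (hu : Summable u) {U : Set ℂ} (hU : IsOpen U) (hf : ∀ i, DifferentiableOn ℂ (f i) U)
    (hle : ∀ i, ∀ z ∈ U, ‖f i z‖ ≤ u i) (m : ℕ) {z : ℂ} (hz : z ∈ U) :
    HasSum (fun i => iteratedDeriv m (f i) z) (iteratedDeriv m (fun w => ∑' i, f i w) z) := by
  have hd : ∀ (m : ℕ) (i : ι), DifferentiableOn ℂ (iteratedDeriv m (f i)) U := by
    intro m i
    induction m with
    | zero => simpa using hf i
    | succ m ih => rw [iteratedDeriv_succ]; exact ih.deriv hU
  have key : TendstoLocallyUniformlyOn (fun (s : Finset ι) w => ∑ i ∈ s, iteratedDeriv m (f i) w)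
      (iteratedDeriv m (fun w => ∑' i, f i w)) atTop U := by
    induction m with
    | zero => simpa using (tendstoUniformlyOn_tsum hu hle).tendstoLocallyUniformlyOn
    | succ m ih =>
      have h := ih.deriv (Eventually.of_forall fun s =>
        DifferentiableOn.fun_sum fun i _ => hd m i) hU
      rw [iteratedDeriv_succ]
      refine h.congr fun s w hw => ?_
      simp only [Function.comp_apply, iteratedDeriv_succ]
      exact deriv_fun_sum fun i _ => (hd m i).differentiableAt (hU.mem_nhds hw)
  exact key.tendsto_at hz

/-- `f` is smooth at `0` and its Taylor series there is `p`. -/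
def HasTaylorSeriesAtZero (f : ℂ → ℂ) (p : PowerSeries ℂ) : Prop :=
  ∀ m : ℕ, ContDiffAt ℂ m f 0 ∧ iteratedDeriv m f 0 = m.factorial * PowerSeries.coeff m p

namespace HasTaylorSeriesAtZero

theorem const (c : ℂ) : HasTaylorSeriesAtZero (fun _ => c) (PowerSeries.C c) := by
  intro m
  refine ⟨contDiffAt_const, ?_⟩
  rw [iteratedDeriv_const, PowerSeries.coeff_C]
  split_ifs with h <;> simp [h]

theorem mul {f g : ℂ → ℂ} {p q : PowerSeries ℂ} (hf : HasTaylorSeriesAtZero f p)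
    (hg : HasTaylorSeriesAtZero g q) : HasTaylorSeriesAtZero (fun z => f z * g z) (p * q) := by
  intro m
  refine ⟨(hf m).1.mul (hg m).1, ?_⟩
  have := iteratedDeriv_mul (hf m).1 (hg m).1
  rw [show (fun z => f z * g z) = f * g from rfl, this, PowerSeries.coeff_mul,
    Finset.Nat.sum_antidiagonal_eq_sum_range_succ_mk, Finset.mul_sum]
  refine Finset.sum_congr rfl fun i hi => ?_
  rw [(hf i).2, (hg (m - i)).2,
    ← Nat.choose_mul_factorial_mul_factorial (Finset.mem_range_succ_iff.mp hi)]
  push_cast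
  ring

theorem prod {ι : Type*} {f : ι → ℂ → ℂ} {p : ι → PowerSeries ℂ} (s : Finset ι)
    (h : ∀ i ∈ s, HasTaylorSeriesAtZero (f i) (p i)) :
    HasTaylorSeriesAtZero (fun z => ∏ i ∈ s, f i z) (∏ i ∈ s, p i) := by
  classical
  induction s using Finset.induction_on with
  | empty => simpa using const 1
  | insert a s ha ih =>
    simp only [Finset.prod_insert ha]
    exact (h a (Finset.mem_insert_self a s)).mul
      (ih fun i hi => h i (Finset.mem_insert_of_mem hi))

theorem sub {f g : ℂ → ℂ} {p q : PowerSeries ℂ} (hf : HasTaylorSeriesAtZero f p)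
    (hg : HasTaylorSeriesAtZero g q) : HasTaylorSeriesAtZero (fun z => f z - g z) (p - q) := by
  intro m
  refine ⟨(hf m).1.sub (hg m).1, ?_⟩
  rw [show (fun z => f z - g z) = f - g from rfl, iteratedDeriv_sub (hf m).1 (hg m).1,
    (hf m).2, (hg m).2, map_sub]
  ring

theorem one_div_add {a : ℂ} (ha : a ≠ 0) :
    HasTaylorSeriesAtZero (fun z => 1 / (a + z))
      (PowerSeries.mk fun l => (-1) ^ l * (1 / a ^ (l + 1))) := by
  intro m
  refine ⟨contDiffAt_const.div (contDiffAt_const.add contDiffAt_id) (by simpa using ha), ?_⟩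
  have h := congrFun (iter_deriv_inv_linear (𝕜 := ℂ) m 1 a) 0
  rw [iteratedDeriv_eq_iterate]
  have e : (fun z : ℂ => 1 / (a + z)) = fun z => (1 * z + a)⁻¹ := by
    ext z; rw [one_mul, one_div, add_comm]
  rw [e, h, PowerSeries.coeff_mk]
  have : (-1 - m : ℤ) = -((m + 1 : ℕ) : ℤ) := by push_cast; ring
  rw [mul_zero, zero_add, this, zpow_neg, zpow_natCast]
  ring

end HasTaylorSeriesAtZero

theorem summable_pi_prod (d : ℕ) {g : ℕ → ℝ} (hg : Summable g) (h0 : ∀ n, 0 ≤ g n) :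
    Summable fun n : Fin d → ℕ => ∏ j, g (n j) := by
  induction d with
  | zero => exact (hasSum_fintype _).summable
  | succ d ih =>
    rw [← (Fin.consEquiv fun _ : Fin (d + 1) => ℕ).summable_iff]
    have := hg.mul_of_nonneg ih h0 fun n => Finset.prod_nonneg fun j _ => h0 (n j)
    refine this.congr fun x => ?_
    simp [Fin.consEquiv, Fin.prod_univ_succ]

theorem exponents_getD (k : List ℕ) (hpos : ∀ x ∈ k, 0 < x) (l : Fin k.length → ℕ) :
    (∀ i : Fin k.length, ((List.ofFn fun i : Fin k.length =>
        List.replicate (k.get i - 1) 1 ++ [l i + 1]).flatten).getD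
          ((k.take (i + 1)).sum - 1) 0 = l i + 1) ∧
    ∀ j < k.sum, (∀ i : Fin k.length, j + 1 ≠ (k.take (i + 1)).sum) →
      ((List.ofFn fun i : Fin k.length =>
        List.replicate (k.get i - 1) 1 ++ [l i + 1]).flatten).getD j 0 = 1 := by
  induction k with
  | nil => simp
  | cons a t ih =>
    have ha : 0 < a := hpos a (by simp)
    obtain ⟨h1, h2⟩ := ih (fun x hx => hpos x (by simp [hx])) fun i => l i.succ
    have hlen : (List.replicate (a - 1) 1 ++ [l 0 + 1]).length = a := by simp; omega
    simp only [List.length_cons, List.ofFn_succ, List.flatten_cons, List.get_cons_zero,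
      List.get_cons_succ']
    generalize (List.ofFn fun i : Fin t.length =>
        List.replicate (t.get i - 1) 1 ++ [l i.succ + 1]).flatten = L at h1 h2 ⊢
    refine ⟨fun i => ?_, fun j hj hne => ?_⟩
    · refine Fin.cases ?_ (fun i => ?_) i
      · rw [List.getD_append _ _ _ _ (by rw [hlen]; simpa using ha),
          List.getD_append_right _ _ _ _ (by simp)]
        simp
      · have hp : 0 < (t.take (i + 1)).sum := by
          refine List.sum_pos _ (fun x hx => hpos x ?_) ?_
          · exact List.mem_cons_of_mem _ (List.mem_of_mem_take hx)
          · have := i.2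
            simp; grind
        have hs : ((a :: t).take (i.succ + 1 : ℕ)).sum = a + (t.take (i + 1)).sum := by
          simp only [Fin.val_succ, List.take_succ_cons, List.sum_cons]
        rw [← h1 i, hs, List.getD_append_right _ _ _ _ (by rw [hlen]; omega), hlen]
        congr 1
        omega
    · by_cases hja : j < a
      · have : j + 1 ≠ a := by simpa using hne 0
        rw [List.getD_append _ _ _ _ (by omega), List.getD_append _ _ _ _ (by simp; omega),
          List.getD_replicate _ (by omega)]
      · rw [List.getD_append_right _ _ _ _ (by omega), hlen]
        refine h2 (j - a) (by rw [List.sum_cons] at hj; omega) fun i hi => hne i.succ ?_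
        simp only [Fin.val_succ, List.take_succ_cons, List.sum_cons]
        omega

theorem sum_take_lt_sum_take {k : List ℕ} (hpos : ∀ x ∈ k, 0 < x) {a b : ℕ} (hab : a < b)
    (hb : b ≤ k.length) : (k.take a).sum < (k.take b).sum := by
  induction b, hab using Nat.le_induction with
  | base =>
    rw [List.sum_take_succ _ _ (by omega)]
    have := hpos k[a] (List.getElem_mem _)
    omega
  | succ b hab ih =>
    rw [List.sum_take_succ k b (by omega)]
    have := ih (by omega)
    omega

/-- The position (counted from `0`) of the last entry of the `i`-th block of `k`. -/
def blockEnd {k : List ℕ} (hpos : ∀ x ∈ k, 0 < x) (i : Fin k.length) : Fin k.sum :=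
  ⟨(k.take (i + 1)).sum - 1, by
    have h1 := sum_take_lt_sum_take hpos (Nat.succ_pos i) i.2
    have h2 := List.sum_take_add_sum_drop k (i + 1)
    simp only [Nat.succ_eq_add_one] at h1
    omega⟩

section blockEnd

variable {k : List ℕ} (hpos : ∀ x ∈ k, 0 < x)

theorem blockEnd_add_one (i : Fin k.length) :
    (blockEnd hpos i : ℕ) + 1 = (k.take (i + 1)).sum := by
  have h1 := sum_take_lt_sum_take hpos (Nat.succ_pos i) i.2
  simp only [Nat.succ_eq_add_one] at h1
  simp only [blockEnd]
  omega

theorem blockEnd_injective : Function.Injective (blockEnd hpos) := by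
  intro a b hab
  have h : (k.take (a + 1)).sum = (k.take (b + 1)).sum := by
    rw [← blockEnd_add_one hpos, ← blockEnd_add_one hpos, hab]
  rcases lt_trichotomy (a : ℕ) b with h1 | h1 | h1
  · exact absurd h (sum_take_lt_sum_take hpos (Nat.succ_lt_succ h1) b.2).ne
  · exact Fin.ext h1
  · exact absurd h (sum_take_lt_sum_take hpos (Nat.succ_lt_succ h1) a.2).ne'

theorem blockEnd_add_one_eq_sum_iff (i : Fin k.length) :
    (blockEnd hpos i : ℕ) + 1 = k.sum ↔ (i : ℕ) + 1 = k.length := by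
  rw [blockEnd_add_one]
  constructor
  · intro h
    by_contra hne
    have := sum_take_lt_sum_take hpos (a := i + 1) (b := k.length) (by omega) le_rfl
    rw [List.take_length] at this
    omega
  · intro h
    rw [h, List.take_length]

theorem blockEnd_add_one_mem_Aset {i : Fin k.length} (hi : (i : ℕ) + 1 ≠ k.length) :
    (blockEnd hpos i : ℕ) + 1 ∈ Aset k := by
  rw [blockEnd_add_one]
  exact Finset.mem_image_of_mem _ (Finset.mem_Ico.mpr ⟨by omega, by omega⟩)

theorem sum_take_ne_of_notMem_image {j : Fin k.sum}
    (hj : j ∉ Finset.univ.image (blockEnd hpos)) (i : Fin k.length) :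
    (j : ℕ) + 1 ≠ (k.take (i + 1)).sum := fun h =>
  hj <| Finset.mem_image.mpr ⟨i, Finset.mem_univ _, Fin.ext <|
    Nat.succ_injective <| (blockEnd_add_one hpos i).trans h.symm⟩

theorem add_one_notMem_Aset_of_notMem_image {j : Fin k.sum}
    (hj : j ∉ Finset.univ.image (blockEnd hpos)) : (j : ℕ) + 1 ∉ Aset k := by
  intro h
  obtain ⟨a, ha, hja⟩ := Finset.mem_image.mp h
  obtain ⟨h1, h2⟩ := Finset.mem_Ico.mp ha
  have := sum_take_ne_of_notMem_image hpos hj ⟨a - 1, by omega⟩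
  simp only [Nat.sub_add_cancel h1] at this
  exact this hja.symm

theorem add_one_ne_sum_of_notMem_image {j : Fin k.sum}
    (hj : j ∉ Finset.univ.image (blockEnd hpos)) : (j : ℕ) + 1 ≠ k.sum := by
  have hk : 0 < k.length := by
    rw [List.length_pos_iff]
    rintro rfl
    exact j.elim0
  have := sum_take_ne_of_notMem_image hpos hj ⟨k.length - 1, by omega⟩
  simpa only [Nat.sub_add_cancel (Nat.succ_le_of_lt hk), List.take_length] using this

theorem prod_eq_prod_mul_prod_blockEnd {M : Type*} [CommMonoid M] (g : Fin k.sum → M) :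
    ∏ j, g j = (∏ j ∈ (Finset.univ.image (blockEnd hpos))ᶜ, g j) *
      ∏ i, g (blockEnd hpos i) := by
  rw [← Finset.prod_compl_mul_prod (Finset.univ.image (blockEnd hpos)),
    Finset.prod_image (blockEnd_injective hpos).injOn]

end blockEnd

/-- The exponents `1,…,1,l₁+1,…,1,…,1,l_r+1` occurring in `C_m(k)`. -/
def exponents (k : List ℕ) (l : Fin k.length → ℕ) : List ℕ :=
  (List.ofFn fun i : Fin k.length => List.replicate (k.get i - 1) 1 ++ [l i + 1]).flatten

theorem exponents_getD_blockEnd {k : List ℕ} (hpos : ∀ x ∈ k, 0 < x) (l : Fin k.length → ℕ)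
    (i : Fin k.length) : (exponents k l).getD (blockEnd hpos i) 0 = l i + 1 :=
  (exponents_getD k hpos l).1 i

theorem exponents_getD_of_notMem_image {k : List ℕ} (hpos : ∀ x ∈ k, 0 < x)
    (l : Fin k.length → ℕ) {j : Fin k.sum} (hj : j ∉ Finset.univ.image (blockEnd hpos)) :
    (exponents k l).getD j 0 = 1 :=
  (exponents_getD k hpos l).2 j j.2 (sum_take_ne_of_notMem_image hpos hj)

/-- The summation condition in `G_k` and `ζ_k`. -/
def Admissible (k : List ℕ) (n : Fin k.sum → ℕ) : Prop :=
  (∀ j, 0 < n j) ∧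
    (∀ (i : Fin k.sum) (h : (i : ℕ) + 1 < k.sum),
      if (i : ℕ) + 1 ∈ Aset k then n i ≤ n ⟨(i : ℕ) + 1, h⟩ else n i < n ⟨(i : ℕ) + 1, h⟩)

theorem Admissible.monotone {k : List ℕ} {n : Fin k.sum → ℕ} (h : Admissible k n) :
    Monotone n := by
  have key : ∀ (d : ℕ) (a : Fin k.sum) (hd : a + d < k.sum), n a ≤ n ⟨a + d, hd⟩ := by
    intro d
    induction d with
    | zero => intro a _; exact le_rfl
    | succ d ih =>
      intro a hd
      refine (ih a (by omega)).trans ?_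
      have := h.2 ⟨a + d, by omega⟩ (by simpa [add_assoc] using hd)
      split_ifs at this
      · exact this
      · exact this.le
  intro a b hab
  have hab' : (a : ℕ) ≤ b := hab
  have := key (b - a) a (by omega)
  simpa [Nat.add_sub_cancel' hab'] using this

open Classical in
/-- A summable majorant for the terms of all series involved. -/
noncomputable def majorant (k : List ℕ) (n : Fin k.sum → ℕ) : ℝ :=
  if Admissible k n then
    ∏ j : Fin k.sum, (1 / (n j : ℝ)) * (if (j : ℕ) + 1 = k.sum then 1 / (n j : ℝ) else 1)
  else 0

theorem summable_majorant (k : List ℕ) : Summable (majorant k) := by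
  rcases Nat.eq_zero_or_pos k.sum with hw | hw
  · have : IsEmpty (Fin k.sum) := by rw [hw]; infer_instance
    exact (hasSum_fintype _).summable
  have hw' : (0 : ℝ) < k.sum := by exact_mod_cast hw
  have hs : Summable fun n : ℕ => (n : ℝ) ^ (-(1 + 1 / (k.sum : ℝ))) := by
    rw [Real.summable_nat_rpow]
    have : 0 < 1 / (k.sum : ℝ) := by positivity
    linarith
  refine (summable_pi_prod k.sum hs fun n => by positivity).of_nonneg_of_le
    (fun n => ?_) fun n => ?_
  · rw [majorant]
    split_ifs
    · refine Finset.prod_nonneg fun j _ => ?_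
      split_ifs <;> positivity
    · exact le_rfl
  · rw [majorant]
    split_ifs with h
    swap
    · exact Finset.prod_nonneg fun j _ => by positivity
    set e : Fin k.sum := ⟨k.sum - 1, by omega⟩ with he
    have hX : 0 < ∏ j, (n j : ℝ) := Finset.prod_pos fun j _ => by exact_mod_cast h.1 j
    have hne : (0 : ℝ) < n e := by exact_mod_cast h.1 e
    have hlast : ∏ j : Fin k.sum, (if (j : ℕ) + 1 = k.sum then 1 / (n j : ℝ) else 1) =
        1 / (n e : ℝ) := by
      rw [Finset.prod_eq_single e]
      · rw [if_pos (by simp only [he]; omega)]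
      · intro b _ hb
        rw [if_neg]
        intro hb'
        exact hb (Fin.ext (by simp only [he]; omega))
      · simp
    have hle : (∏ j, (n j : ℝ)) ^ (1 / (k.sum : ℝ)) ≤ n e := by
      have h1 : ∏ j, (n j : ℝ) ≤ (n e : ℝ) ^ k.sum := by
        calc ∏ j, (n j : ℝ) ≤ ∏ _j : Fin k.sum, (n e : ℝ) := by
              refine Finset.prod_le_prod (fun _ _ => by positivity) fun j _ => ?_
              exact_mod_cast h.monotone (by
                rw [Fin.le_def]; simp only [he]; omega)
          _ = _ := by simp
      calc _ ≤ ((n e : ℝ) ^ k.sum) ^ (1 / (k.sum : ℝ)) := by gcongr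
        _ = n e := by rw [one_div, Real.pow_rpow_inv_natCast hne.le hw.ne']
    rw [Finset.prod_mul_distrib, hlast, Real.finsetProd_rpow _ _ fun _ _ => by positivity,
      Real.rpow_neg hX.le, Real.rpow_add hX, Real.rpow_one, mul_inv, Finset.prod_div_distrib,
      Finset.prod_const_one, one_div, one_div]
    gcongr

open Classical in
/-- The summand of `ζ_k(l)`. -/
noncomputable def zetaTerm (k l : List ℕ) (n : Fin k.sum → ℕ) : ℝ :=
  if Admissible k n then ∏ j : Fin k.sum, 1 / (n j : ℝ) ^ (l.getD (j : ℕ) 0) else 0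

open Classical in
/-- The summand of `G_k(z)`. -/
noncomputable def GTerm (k : List ℕ) (n : Fin k.sum → ℕ) (z : ℂ) : ℂ :=
  if Admissible k n then ∏ j : Fin k.sum,
      if (j : ℕ) + 1 = k.sum then 1 / ((n j : ℕ) : ℂ) - 1 / (((n j : ℕ) : ℂ) + z)
      else if (j : ℕ) + 1 ∈ Aset k then 1 / (((n j : ℕ) : ℂ) + z)
      else 1 / ((n j : ℕ) : ℂ)
    else 0

open Classical in
theorem zetaIdx_eq_tsum (k l : List ℕ) : zetaIdx k l = ∑' n, zetaTerm k l n :=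
  tsum_congr fun _ => if_congr Iff.rfl rfl rfl

open Classical in
theorem G_eq_tsum (k : List ℕ) : G k = fun z => ∑' n, GTerm k n z :=
  funext fun _ => tsum_congr fun _ => if_congr Iff.rfl rfl rfl

theorem summable_zetaTerm_exponents {k : List ℕ} (hpos : ∀ x ∈ k, 0 < x)
    {l : Fin k.length → ℕ} (hl : ∀ i : Fin k.length, (i : ℕ) + 1 = k.length → 1 ≤ l i) :
    Summable (zetaTerm k (exponents k l)) := by
  refine (summable_majorant k).of_nonneg_of_le (fun n => ?_) fun n => ?_
  · rw [zetaTerm]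
    split_ifs
    · positivity
    · exact le_rfl
  · rw [zetaTerm, majorant]
    split_ifs with h
    swap
    · exact le_rfl
    refine Finset.prod_le_prod (fun _ _ => by positivity) fun j _ => ?_
    have hn : (1 : ℝ) ≤ n j := by exact_mod_cast h.1 j
    have h1 : 1 / (n j : ℝ) ≤ 1 := by rw [div_le_one (by positivity)]; exact hn
    rw [← one_div_pow]
    by_cases hj : j ∈ Finset.univ.image (blockEnd hpos)
    · obtain ⟨i, -, rfl⟩ := Finset.mem_image.mp hj
      rw [exponents_getD_blockEnd, pow_succ']
      gcongr
      split_ifs with hi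
      · exact pow_le_of_le_one (by positivity) h1
          (Nat.one_le_iff_ne_zero.mp (hl i ((blockEnd_add_one_eq_sum_iff hpos i).mp hi)))
      · exact pow_le_one₀ (by positivity) h1
    · rw [exponents_getD_of_notMem_image hpos _ hj, pow_one,
        if_neg (add_one_ne_sum_of_notMem_image hpos hj), mul_one]

theorem half_le_norm_natCast_add {N : ℕ} (hN : 0 < N) {z : ℂ} (hz : z ∈ Metric.ball (0 : ℂ) (1 / 2)) :
    (N : ℝ) / 2 ≤ ‖(N : ℂ) + z‖ := by
  rw [mem_ball_zero_iff] at hz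
  have h1 : (1 : ℝ) ≤ N := by exact_mod_cast hN
  have h2 := norm_sub_le ((N : ℂ) + z) z
  rw [add_sub_cancel_right, Complex.norm_natCast] at h2
  linarith

theorem norm_GTerm_le (k : List ℕ) (n : Fin k.sum → ℕ) {z : ℂ}
    (hz : z ∈ Metric.ball (0 : ℂ) (1 / 2)) : ‖GTerm k n z‖ ≤ 2 ^ k.sum * majorant k n := by
  rw [GTerm, majorant]
  split_ifs with h
  swap
  · simp
  have e : (2 : ℝ) ^ k.sum = ∏ _j : Fin k.sum, 2 := by simp
  rw [norm_prod, e, ← Finset.prod_mul_distrib]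
  refine Finset.prod_le_prod (fun _ _ => norm_nonneg _) fun j _ => ?_
  have hn : (1 : ℝ) ≤ n j := by exact_mod_cast h.1 j
  have hn0 : ((n j : ℕ) : ℂ) ≠ 0 := by exact_mod_cast (h.1 j).ne'
  have hle := half_le_norm_natCast_add (h.1 j) hz
  have hz0 : ((n j : ℕ) : ℂ) + z ≠ 0 := by rw [← norm_pos_iff]; linarith
  have hi : ‖((n j : ℕ) : ℂ) + z‖⁻¹ ≤ 2 * (n j : ℝ)⁻¹ := by
    rw [inv_le_comm₀ (by linarith) (by positivity)]
    simpa [div_eq_mul_inv, mul_comm] using hle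
  rw [mem_ball_zero_iff] at hz
  split_ifs
  · rw [div_sub_div _ _ hn0 hz0]
    simp only [one_mul, mul_one, add_sub_cancel_left, norm_div, norm_mul, Complex.norm_natCast,
      one_div]
    rw [div_eq_mul_inv, mul_inv, ← mul_assoc 2]
    calc ‖z‖ * ((n j : ℝ)⁻¹ * ‖((n j : ℕ) : ℂ) + z‖⁻¹)
        ≤ 1 * ((n j : ℝ)⁻¹ * (2 * (n j : ℝ)⁻¹)) := by gcongr; linarith
      _ = _ := by ring
  · simpa using hi
  · simp only [norm_div, norm_one, Complex.norm_natCast, mul_one]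
    have : 0 ≤ 1 / (n j : ℝ) := by positivity
    linarith

theorem differentiableOn_GTerm (k : List ℕ) (n : Fin k.sum → ℕ) :
    DifferentiableOn ℂ (GTerm k n) (Metric.ball 0 (1 / 2)) := by
  unfold GTerm
  split_ifs with h
  swap
  · exact differentiableOn_const 0
  refine DifferentiableOn.fun_finsetProd fun j _ => ?_
  have hz0 : ∀ z ∈ Metric.ball (0 : ℂ) (1 / 2), ((n j : ℕ) : ℂ) + z ≠ 0 := fun z hz => by
    have hn : (1 : ℝ) ≤ n j := by exact_mod_cast h.1 j
    have := half_le_norm_natCast_add (h.1 j) hz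
    rw [← norm_pos_iff]; linarith
  have hd : DifferentiableOn ℂ (fun z : ℂ => 1 / (((n j : ℕ) : ℂ) + z))
      (Metric.ball 0 (1 / 2)) :=
    (differentiableOn_const 1).div (by fun_prop) hz0
  split_ifs
  · exact (differentiableOn_const _).sub hd
  · exact hd
  · exact differentiableOn_const _

/-- The Taylor series at `0` of `1 / (a + z)`. -/
noncomputable def invSeries (a : ℂ) : PowerSeries ℂ :=
  PowerSeries.mk fun l => (-1) ^ l * (1 / a ^ (l + 1))

theorem coeff_prod_invSeries {r m : ℕ} (hr : 0 < r) (hm : 1 ≤ m) (N : Fin r → ℂ) :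
    PowerSeries.coeff m (∏ i : Fin r, if (i : ℕ) + 1 = r then
        PowerSeries.C (1 / N i) - invSeries (N i) else invSeries (N i)) =
      (-1) ^ (m - 1) * ∑ l : Fin r → Fin (m + 1),
        if (∑ i, (l i : ℕ)) = m ∧ (∀ i : Fin r, (i : ℕ) + 1 = r → 1 ≤ (l i : ℕ))
        then ∏ i, 1 / N i ^ ((l i : ℕ) + 1) else 0 := by
  have hc : ∀ (i : Fin r) (d : ℕ), PowerSeries.coeff d (if (i : ℕ) + 1 = r then
      PowerSeries.C (1 / N i) - invSeries (N i) else invSeries (N i)) =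
      (if (i : ℕ) + 1 = r then (if d = 0 then 0 else -1) else 1) *
        ((-1) ^ d * (1 / N i ^ (d + 1))) := by
    intro i d
    split_ifs with h1 h2
    · simp [invSeries, h2]
    · simp [invSeries, PowerSeries.coeff_C, h2]
    · simp [invSeries]
  have hlast : ∀ l : Fin r → ℕ, (∏ i : Fin r,
      if (i : ℕ) + 1 = r then (if l i = 0 then (0 : ℂ) else -1) else 1) =
      if ∀ i : Fin r, (i : ℕ) + 1 = r → 1 ≤ l i then -1 else 0 := by
    intro l
    have he : ∀ i : Fin r, (i : ℕ) + 1 = r ↔ i = ⟨r - 1, by omega⟩ := fun i => by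
      rw [Fin.ext_iff]; simp only; omega
    simp only [he, Finset.prod_ite_eq', Finset.mem_univ, if_true, forall_eq,
      Nat.one_le_iff_ne_zero]
    split_ifs <;> simp_all
  rw [PowerSeries.coeff_prod, Finset.mul_sum, Finset.sum_congr rfl fun l _ =>
    Finset.prod_congr rfl fun i _ => hc i (l i)]
  simp only [Finset.prod_mul_distrib]
  simp only [hlast]
  have hsign : (-1 : ℂ) ^ (m - 1) = -(-1) ^ m := by
    obtain ⟨m, rfl⟩ := Nat.exists_eq_add_of_le hm
    rw [add_tsub_cancel_left, pow_add]; ring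
  have hle : ∀ l : Fin r →₀ ℕ, l ∈ Finset.finsuppAntidiag Finset.univ m → ∀ i, l i < m + 1 := by
    intro l hl i
    rw [← (Finset.mem_finsuppAntidiag.mp hl).1]
    exact Nat.lt_succ_of_le
      (Finset.single_le_sum (f := l) (fun _ _ => Nat.zero_le _) (Finset.mem_univ i))
  rw [← Finset.sum_filter_of_ne (s := Finset.univ) (p := fun l : Fin r → Fin (m + 1) =>
    (∑ i, (l i : ℕ)) = m) fun l _ hl => by
      by_contra h
      simp [h] at hl]
  refine Finset.sum_bij' (fun l hl i => ⟨l i, hle l hl i⟩)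
    (fun l _ => Finsupp.equivFunOnFinite.symm fun i => (l i : ℕ)) ?_ ?_ ?_ ?_ ?_
  · intro l hl
    simpa using (Finset.mem_finsuppAntidiag.mp hl).1
  · intro l hl
    simpa [Finset.mem_finsuppAntidiag] using hl
  · intro l hl
    ext i
    simp
  · intro l hl
    ext i
    simp
  · intro l hl
    have hs := (Finset.mem_finsuppAntidiag.mp hl).1
    simp only [hs, true_and, Finset.prod_pow_eq_pow_sum]
    split_ifs
    · rw [hsign]; ring
    · simp

theorem iteratedDeriv_GTerm {k : List ℕ} (hk : k ≠ []) (hpos : ∀ x ∈ k, 0 < x) {m : ℕ}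
    (hm : 1 ≤ m) (n : Fin k.sum → ℕ) :
    iteratedDeriv m (GTerm k n) 0 = m.factorial * ((-1) ^ (m - 1) *
      ∑ l : Fin k.length → Fin (m + 1),
        if (∑ i, (l i : ℕ)) = m ∧ (∀ i : Fin k.length, (i : ℕ) + 1 = k.length → 1 ≤ (l i : ℕ))
        then ((zetaTerm k (exponents k fun i => l i) n : ℝ) : ℂ) else 0) := by
  unfold GTerm zetaTerm
  by_cases h : Admissible k n
  swap
  · simp [h]
  have hn0 : ∀ j, ((n j : ℕ) : ℂ) ≠ 0 := fun j => by exact_mod_cast (h.1 j).ne'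
  set c : ℂ := ∏ j ∈ (Finset.univ.image (blockEnd hpos))ᶜ, 1 / ((n j : ℕ) : ℂ) with hc
  have hT := (HasTaylorSeriesAtZero.const c).mul (HasTaylorSeriesAtZero.prod Finset.univ
    (f := fun (i : Fin k.length) z => if (i : ℕ) + 1 = k.length then
      1 / ((n (blockEnd hpos i) : ℕ) : ℂ) - 1 / (((n (blockEnd hpos i) : ℕ) : ℂ) + z)
      else 1 / (((n (blockEnd hpos i) : ℕ) : ℂ) + z))
    (p := fun i => if (i : ℕ) + 1 = k.length then
      PowerSeries.C (1 / ((n (blockEnd hpos i) : ℕ) : ℂ)) -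
        invSeries ((n (blockEnd hpos i) : ℕ) : ℂ)
      else invSeries ((n (blockEnd hpos i) : ℕ) : ℂ)) fun i _ => by
    split_ifs
    · exact (HasTaylorSeriesAtZero.const _).sub (.one_div_add (hn0 _))
    · exact .one_div_add (hn0 _))
  simp only [h, if_true]
  have hfun : (fun z : ℂ => ∏ j : Fin k.sum,
      if (j : ℕ) + 1 = k.sum then 1 / ((n j : ℕ) : ℂ) - 1 / (((n j : ℕ) : ℂ) + z)
      else if (j : ℕ) + 1 ∈ Aset k then 1 / (((n j : ℕ) : ℂ) + z)
      else 1 / ((n j : ℕ) : ℂ)) = fun z => c * ∏ i : Fin k.length,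
      if (i : ℕ) + 1 = k.length then
      1 / ((n (blockEnd hpos i) : ℕ) : ℂ) - 1 / (((n (blockEnd hpos i) : ℕ) : ℂ) + z)
      else 1 / (((n (blockEnd hpos i) : ℕ) : ℂ) + z) := by
    ext z
    rw [prod_eq_prod_mul_prod_blockEnd hpos, hc]
    congr 1
    · refine Finset.prod_congr rfl fun j hj => ?_
      rw [Finset.mem_compl] at hj
      rw [if_neg (add_one_ne_sum_of_notMem_image hpos hj),
        if_neg (add_one_notMem_Aset_of_notMem_image hpos hj)]
    · refine Finset.prod_congr rfl fun i _ => ?_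
      simp only [blockEnd_add_one_eq_sum_iff]
      split_ifs with h1 h2
      · rfl
      · rfl
      · exact absurd (blockEnd_add_one_mem_Aset hpos h1) h2
  rw [hfun, (hT m).2, PowerSeries.coeff_C_mul,
    coeff_prod_invSeries (List.length_pos_iff.mpr hk) hm, mul_left_comm c, Finset.mul_sum]
  congr 3
  ext l
  split_ifs
  · push_cast
    rw [prod_eq_prod_mul_prod_blockEnd hpos, hc]
    congr 1
    · refine Finset.prod_congr rfl fun j hj => ?_
      rw [Finset.mem_compl] at hj
      rw [exponents_getD_of_notMem_image hpos _ hj, pow_one]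
    · refine Finset.prod_congr rfl fun i _ => ?_
      rw [exponents_getD_blockEnd]
  · simp

/-- `G_k^{(m)}(0)/m! = (-1)^{m-1} C_m(k)` for `m ≥ 1`. -/
theorem G_iteratedDeriv_zero (k : List ℕ) (hk : k ≠ []) (hpos : ∀ x ∈ k, 0 < x)
    (m : ℕ) (hm : 1 ≤ m) :
    iteratedDeriv m (G k) 0 / (m.factorial : ℕ) =
      (-1 : ℂ) ^ (m - 1) * ((Cm k m : ℝ) : ℂ) := by
  have h1 := hasSum_iteratedDeriv_of_summable_norm ((summable_majorant k).mul_left (2 ^ k.sum))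
    Metric.isOpen_ball (differentiableOn_GTerm k) (fun n z hz => norm_GTerm_le k n hz) m
    (Metric.mem_ball_self (by norm_num : (0 : ℝ) < 1 / 2))
  rw [← G_eq_tsum] at h1
  simp only [iteratedDeriv_GTerm hk hpos hm] at h1
  have h2 : HasSum (fun n => (m.factorial : ℂ) * ((-1) ^ (m - 1) *
      ∑ l : Fin k.length → Fin (m + 1),
        if (∑ i, (l i : ℕ)) = m ∧ (∀ i : Fin k.length, (i : ℕ) + 1 = k.length → 1 ≤ (l i : ℕ))
        then ((zetaTerm k (exponents k fun i => l i) n : ℝ) : ℂ) else 0))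
      ((m.factorial : ℂ) * ((-1) ^ (m - 1) * ((Cm k m : ℝ) : ℂ))) := by
    refine HasSum.mul_left _ (HasSum.mul_left _ ?_)
    rw [Cm, Complex.ofReal_sum]
    refine hasSum_sum fun l _ => ?_
    split_ifs with h
    · rw [← exponents, zetaIdx_eq_tsum]
      exact Complex.hasSum_ofReal.mpr
        (summable_zetaTerm_exponents (l := fun i => (l i : ℕ)) hpos h.2).hasSum
    · simp
  rw [h1.unique h2, mul_div_cancel_left₀ _ (by exact_mod_cast m.factorial_ne_zero)]

end Kawashima
end
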